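/- arXiv:1706.03989 — 2 statements merged into one kernel-verified Lean document; each statement's English description precedes it below -/
import Mathlib

section
/- Let μ be a (positive Borel) measure on ℝ such that ∫_ℝ 1/(x²+1) dμ(x) < ∞, and define F(z) = (1/(2πi)) ∫_ℝ (1/(x−z) − 1/(x−i)) dμ(x) for z ∈ ℂ \ ℝ. Then F is holomorphic on ℂ \ ℝ, and for every continuous compactly supported function g : ℝ → ℂ one has lim_{y→0+} ∫_ℝ (F(x+iy) − F(x−iy)) g(x) dx = ∫_ℝ g(x) dμ(x); that is, the hyperfunction boundary value of F is the measure μ. -/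
open MeasureTheory Complex Filter Topology

/-- A measure against which `1 / (x ^ 2 + 1)` is integrable is locally finite. -/
lemma isLocallyFiniteMeasure_of_integrable_one_div_sq_add_one {μ : Measure ℝ}
    (hint : Integrable (fun x : ℝ => 1 / (x ^ 2 + 1)) μ) : IsLocallyFiniteMeasure μ := by
  refine ⟨fun x => ?_⟩
  have hx : 0 < 1 / (x ^ 2 + 1) := by positivity
  refine ⟨_, ?_, hint.measure_norm_ge_lt_top (half_pos hx)⟩
  have hc : Continuous fun x : ℝ => ‖1 / (x ^ 2 + 1)‖ := by
    refine (continuous_const.div (by fun_prop) fun y => ?_).norm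
    positivity
  refine (hc.tendsto x).eventually (eventually_ge_nhds ?_)
  rw [Real.norm_of_nonneg hx.le]
  exact half_lt_self hx

lemma ofReal_sub_ne_zero {z : ℂ} (hz : z.im ≠ 0) (t : ℝ) : (t : ℂ) - z ≠ 0 := by
  intro h
  apply hz
  simpa using congrArg Complex.im h

lemma sq_norm_ofReal_sub_I (t : ℝ) : ‖(t : ℂ) - I‖ ^ 2 = t ^ 2 + 1 := by
  rw [Complex.sq_norm, Complex.normSq_apply]
  simp
  ring

/-- The distance from a real point to `z` is comparable with its distance to `I`. -/
lemma norm_ofReal_sub_I_le {z : ℂ} {δ R : ℝ} (hδ : 0 < δ) (hz : δ ≤ |z.im|) (hR : ‖z - I‖ ≤ R)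
    (t : ℝ) : ‖(t : ℂ) - I‖ ≤ (1 + R / δ) * ‖(t : ℂ) - z‖ := by
  have hd : δ ≤ ‖(t : ℂ) - z‖ := hz.trans (by simpa using Complex.abs_im_le_norm ((t : ℂ) - z))
  have hR0 : 0 ≤ R := (norm_nonneg _).trans hR
  have h1 : ‖(t : ℂ) - I‖ ≤ ‖(t : ℂ) - z‖ + ‖z - I‖ := norm_sub_le_norm_sub_add_norm_sub _ _ _
  have h2 : R ≤ R / δ * ‖(t : ℂ) - z‖ := by
    calc R = R / δ * δ := by field_simp
      _ ≤ _ := by gcongr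
  linarith

lemma inv_sq_norm_ofReal_sub_le {z : ℂ} {δ R : ℝ} (hδ : 0 < δ) (hz : δ ≤ |z.im|)
    (hR : ‖z - I‖ ≤ R) (t : ℝ) :
    1 / ‖(t : ℂ) - z‖ ^ 2 ≤ (1 + R / δ) ^ 2 * (1 / (t ^ 2 + 1)) := by
  have hz0 : z.im ≠ 0 := fun h => by simp [h] at hz; linarith
  have hpos : 0 < ‖(t : ℂ) - z‖ := norm_pos_iff.2 (ofReal_sub_ne_zero hz0 t)
  have h := norm_ofReal_sub_I_le hδ hz hR t
  rw [mul_one_div, div_le_div_iff₀ (by positivity) (by positivity), ← sq_norm_ofReal_sub_I, one_mul,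
    ← mul_pow]
  gcongr

lemma continuous_one_div_ofReal_sub {z : ℂ} (hz : z.im ≠ 0) :
    Continuous fun t : ℝ => 1 / ((t : ℂ) - z) :=
  continuous_const.div (by fun_prop) (ofReal_sub_ne_zero hz)

lemma integrable_cauchyKernel {μ : Measure ℝ}
    (hint : Integrable (fun x : ℝ => 1 / (x ^ 2 + 1)) μ) {z : ℂ} (hz : z.im ≠ 0) :
    Integrable (fun t : ℝ => 1 / ((t : ℂ) - z) - 1 / ((t : ℂ) - I)) μ := by
  have hI : I.im ≠ 0 := by simp
  refine (hint.const_mul ((1 + ‖z - I‖ / |z.im|) * ‖z - I‖)).mono'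
    ((continuous_one_div_ofReal_sub hz).sub
      (continuous_one_div_ofReal_sub hI)).aestronglyMeasurable (ae_of_all _ fun t => ?_)
  have hzt := ofReal_sub_ne_zero hz t
  have hIt := ofReal_sub_ne_zero hI t
  have h : 1 / ((t : ℂ) - z) - 1 / ((t : ℂ) - I) = (z - I) / (((t : ℂ) - z) * ((t : ℂ) - I)) := by
    field_simp
    ring
  have h1 := norm_ofReal_sub_I_le (abs_pos.2 hz) le_rfl le_rfl t
  have hzt' := norm_pos_iff.2 hzt
  have hIt' := norm_pos_iff.2 hIt
  rw [h, norm_div, norm_mul, mul_one_div, ← sq_norm_ofReal_sub_I,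
    div_le_div_iff₀ (by positivity) (by positivity)]
  calc ‖z - I‖ * ‖(t : ℂ) - I‖ ^ 2 = ‖z - I‖ * ‖(t : ℂ) - I‖ * ‖(t : ℂ) - I‖ := by ring
    _ ≤ ‖z - I‖ * ((1 + ‖z - I‖ / |z.im|) * ‖(t : ℂ) - z‖) * ‖(t : ℂ) - I‖ := by gcongr
    _ = _ := by ring

/-- The Cauchy transform of `μ`, normalized at `I`, is holomorphic off the real line. -/
lemma differentiableAt_integral_cauchyKernel {μ : Measure ℝ}
    (hint : Integrable (fun x : ℝ => 1 / (x ^ 2 + 1)) μ) {z : ℂ} (hz : z.im ≠ 0) :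
    DifferentiableAt ℂ (fun w : ℂ => ∫ t : ℝ, (1 / ((t : ℂ) - w) - 1 / ((t : ℂ) - I)) ∂μ) z := by
  have hδ : 0 < |z.im| / 2 := half_pos (abs_pos.2 hz)
  have him : ∀ w ∈ Metric.ball z (|z.im| / 2), |z.im| / 2 ≤ |w.im| := by
    intro w hw
    have h1 : |z.im| - |w.im| ≤ |w.im - z.im| := by
      rw [abs_sub_comm]
      exact abs_sub_abs_le_abs_sub _ _
    have h2 : |w.im - z.im| ≤ ‖w - z‖ := by simpa using Complex.abs_im_le_norm (w - z)
    rw [mem_ball_iff_norm] at hw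
    linarith
  have hne : ∀ w ∈ Metric.ball z (|z.im| / 2), w.im ≠ 0 := fun w hw =>
    abs_pos.1 (hδ.trans_le (him w hw))
  have hR : ∀ w ∈ Metric.ball z (|z.im| / 2), ‖w - I‖ ≤ |z.im| / 2 + ‖z - I‖ := by
    intro w hw
    rw [mem_ball_iff_norm] at hw
    have := norm_sub_le_norm_sub_add_norm_sub w z I
    linarith
  have hball := Metric.ball_mem_nhds z hδ
  refine (hasDerivAt_integral_of_dominated_loc_of_deriv_le (μ := μ)
    (F' := fun w (t : ℝ) => 1 / ((t : ℂ) - w) ^ 2) (bound := fun t : ℝ =>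
      (1 + (|z.im| / 2 + ‖z - I‖) / (|z.im| / 2)) ^ 2 * (1 / (t ^ 2 + 1)))
    hball ?_ (integrable_cauchyKernel hint hz) ?_ (ae_of_all _ fun t w hw => ?_)
    (hint.const_mul ((1 + (|z.im| / 2 + ‖z - I‖) / (|z.im| / 2)) ^ 2))
    (ae_of_all _ fun t w hw => ?_)).2.differentiableAt
  · filter_upwards [hball] with w hw
    exact (integrable_cauchyKernel hint (hne w hw)).aestronglyMeasurable
  · refine (continuous_const.div (by fun_prop) fun t => ?_).aestronglyMeasurable
    exact pow_ne_zero 2 (ofReal_sub_ne_zero hz t)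
  · rw [norm_div, norm_pow, norm_one]
    exact inv_sq_norm_ofReal_sub_le hδ (him w hw) (hR w hw) t
  · have h := (((hasDerivAt_id w).const_sub (t : ℂ)).inv
      (ofReal_sub_ne_zero (hne w hw) t)).sub_const (1 / ((t : ℂ) - I))
    simpa [one_div, Pi.inv_def] using h

/-- The Poisson kernel of the upper half plane, without its factor `1 / π`. -/
noncomputable def halfPlanePoisson (y t x : ℝ) : ℝ := y / ((t - x) ^ 2 + y ^ 2)

lemma halfPlanePoisson_nonneg {y : ℝ} (hy : 0 < y) (t x : ℝ) : 0 ≤ halfPlanePoisson y t x := by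
  unfold halfPlanePoisson
  positivity

lemma continuous_halfPlanePoisson {y : ℝ} (hy : 0 < y) :
    Continuous fun p : ℝ × ℝ => halfPlanePoisson y p.1 p.2 := by
  unfold halfPlanePoisson
  refine continuous_const.div (by fun_prop) fun p => ?_
  positivity

lemma integral_halfPlanePoisson_smul {E : Type*} [NormedAddCommGroup E] [NormedSpace ℝ E]
    {y : ℝ} (hy : 0 < y) (t : ℝ) (h : ℝ → E) :
    ∫ x, halfPlanePoisson y t x • h x = ∫ u, (1 + u ^ 2)⁻¹ • h (t + y * u) := by
  have e : ∀ u : ℝ, (1 + u ^ 2)⁻¹ • h (t + y * u) =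
      y • (halfPlanePoisson y t (t + y * u) • h (t + y * u)) := by
    intro u
    rw [smul_smul]
    congr 1
    unfold halfPlanePoisson
    have h1 : (t - (t + y * u)) ^ 2 + y ^ 2 = y ^ 2 * (1 + u ^ 2) := by ring
    rw [h1]
    field_simp
  simp_rw [e]
  rw [integral_smul,
    Measure.integral_comp_mul_left (fun v => halfPlanePoisson y t (t + v) • h (t + v)) y,
    integral_add_left_eq_self (fun v => halfPlanePoisson y t v • h v) t, smul_smul,
    abs_of_pos (inv_pos.2 hy), mul_inv_cancel₀ hy.ne', one_smul]

lemma integral_halfPlanePoisson {y : ℝ} (hy : 0 < y) (t : ℝ) :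
    ∫ x, halfPlanePoisson y t x = Real.pi := by
  have h := integral_halfPlanePoisson_smul hy t fun _ => (1 : ℝ)
  simpa using h

lemma integrable_halfPlanePoisson {y : ℝ} (hy : 0 < y) (t : ℝ) :
    Integrable (halfPlanePoisson y t) := by
  by_contra h
  have h1 := integral_halfPlanePoisson hy t
  rw [integral_undef h] at h1
  exact Real.pi_ne_zero h1.symm

lemma halfPlanePoisson_eq_div_norm (y t x : ℝ) :
    halfPlanePoisson y t x = y * (1 / ‖(t : ℂ) - ((x : ℂ) + (y : ℂ) * I)‖ ^ 2) := by
  rw [Complex.sq_norm, Complex.normSq_apply, halfPlanePoisson, mul_one_div]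
  congr 1
  simp
  ring

lemma cauchyKernel_jump {y : ℝ} (hy : 0 < y) (t x : ℝ) :
    1 / (2 * Real.pi * I) * ((1 / ((t : ℂ) - ((x : ℂ) + (y : ℂ) * I)) - 1 / ((t : ℂ) - I)) -
      (1 / ((t : ℂ) - ((x : ℂ) - (y : ℂ) * I)) - 1 / ((t : ℂ) - I))) =
      ((halfPlanePoisson y t x / Real.pi : ℝ) : ℂ) := by
  have h1 : (t : ℂ) - ((x : ℂ) + (y : ℂ) * I) ≠ 0 := ofReal_sub_ne_zero (by simpa using hy.ne') t
  have h2 : (t : ℂ) - ((x : ℂ) - (y : ℂ) * I) ≠ 0 := ofReal_sub_ne_zero (by simpa using hy.ne') t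
  have h3 : ((t : ℂ) - x) ^ 2 + (y : ℂ) ^ 2 =
      ((t : ℂ) - ((x : ℂ) + (y : ℂ) * I)) * ((t : ℂ) - ((x : ℂ) - (y : ℂ) * I)) := by
    linear_combination (y : ℂ) ^ 2 * I_sq
  have hpi : (Real.pi : ℂ) ≠ 0 := by exact_mod_cast Real.pi_ne_zero
  have hI := I_ne_zero
  have h4 : (t : ℂ) - ((x : ℂ) - (y : ℂ) * I) - ((t : ℂ) - ((x : ℂ) + (y : ℂ) * I)) =
      2 * y * I := by ring
  unfold halfPlanePoisson
  push_cast
  rw [h3, sub_sub_sub_cancel_right, div_sub_div _ _ h1 h2, one_mul, mul_one, h4]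
  field_simp

/-- Fubini for the Poisson integral of `μ` tested against `g`. -/
lemma integral_integral_halfPlanePoisson_swap {μ : Measure ℝ} [SFinite μ]
    (hint : Integrable (fun x : ℝ => 1 / (x ^ 2 + 1)) μ) {g : ℝ → ℂ} (hg : Continuous g)
    (hgs : HasCompactSupport g) {y : ℝ} (hy : 0 < y) :
    ∫ x, ∫ t, halfPlanePoisson y t x • g x ∂μ = ∫ t, (∫ x, halfPlanePoisson y t x • g x) ∂μ := by
  obtain ⟨R, hR⟩ := hgs.isCompact.exists_bound_of_continuousOn
    (f := fun x : ℝ => (x : ℂ) + (y : ℂ) * I - I) (by fun_prop)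
  refine integral_integral_swap ?_
  refine (((hg.integrable_of_hasCompactSupport hgs).norm.const_mul
    (y * (1 + R / y) ^ 2)).mul_prod hint).mono' ?_ (ae_of_all _ fun p => ?_)
  · have h := (continuous_halfPlanePoisson hy).comp (continuous_snd.prodMk continuous_fst)
    exact (h.smul (hg.comp continuous_fst)).aestronglyMeasurable
  · obtain ⟨x, t⟩ := p
    simp only [Function.uncurry]
    rw [norm_smul, Real.norm_of_nonneg (halfPlanePoisson_nonneg hy t x)]
    by_cases hx : x ∈ tsupport g
    · have h := inv_sq_norm_ofReal_sub_le (z := (x : ℂ) + (y : ℂ) * I) hy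
        (by simp [abs_of_pos hy]) (hR x hx) t
      rw [halfPlanePoisson_eq_div_norm]
      calc _ ≤ y * ((1 + R / y) ^ 2 * (1 / (t ^ 2 + 1))) * ‖g x‖ := by gcongr
        _ = _ := by ring
    · simp [image_eq_zero_of_notMem_tsupport hx]

/-- The Poisson integral of a bounded continuous function converges pointwise to `π` times it. -/
lemma tendsto_integral_halfPlanePoisson_smul {g : ℝ → ℂ} (hg : Continuous g) {M : ℝ}
    (hM : ∀ x, ‖g x‖ ≤ M) (t : ℝ) :
    Tendsto (fun y : ℝ => ∫ x, halfPlanePoisson y t x • g x) (𝓝[>] 0) (𝓝 (Real.pi • g t)) := by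
  have h : Tendsto (fun y : ℝ => ∫ u : ℝ, (1 + u ^ 2)⁻¹ • g (t + y * u)) (𝓝[>] 0)
      (𝓝 (∫ u : ℝ, (1 + u ^ 2)⁻¹ • g t)) := by
    refine tendsto_integral_filter_of_dominated_convergence (fun u => (1 + u ^ 2)⁻¹ * M)
      (Eventually.of_forall fun y => ?_) (Eventually.of_forall fun y => ae_of_all _ fun u => ?_)
      (integrable_inv_one_add_sq.mul_const M) (ae_of_all _ fun u => ?_)
    · have hc : Continuous fun u : ℝ => g (t + y * u) := hg.comp (by fun_prop)
      have hk : Continuous fun u : ℝ => (1 + u ^ 2)⁻¹ :=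
        Continuous.inv₀ (by fun_prop) fun u => by positivity
      exact (hk.smul hc).aestronglyMeasurable
    · have hu : 0 ≤ (1 + u ^ 2)⁻¹ := by positivity
      rw [norm_smul, Real.norm_of_nonneg hu]
      exact mul_le_mul_of_nonneg_left (hM _) hu
    · have hc : Continuous fun y : ℝ => g (t + y * u) := hg.comp (by fun_prop)
      have h0 := (hc.tendsto 0).mono_left (nhdsWithin_le_nhds (s := Set.Ioi 0))
      rw [zero_mul, add_zero] at h0
      exact h0.const_smul _
  rw [integral_smul_const, integral_univ_inv_one_add_sq] at h
  refine h.congr' ?_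
  filter_upwards [self_mem_nhdsWithin] with y hy
  exact (integral_halfPlanePoisson_smul hy t g).symm

/-- Poisson integrals of a compactly supported function decay like `1 / (t ^ 2 + 1)`, uniformly in
the height. -/
lemma norm_integral_halfPlanePoisson_smul_le {g : ℝ → ℂ} (hg : Integrable g) {M R : ℝ}
    (hM : ∀ x, ‖g x‖ ≤ M) (hR : ∀ x, g x ≠ 0 → |x| ≤ R) {y : ℝ} (hy : 0 < y) (hy1 : y ≤ 1)
    (t : ℝ) :
    ‖∫ x, halfPlanePoisson y t x • g x‖ ≤
      ((1 + 2 * R ^ 2) * M * Real.pi + 2 * ∫ x, ‖g x‖) * (1 / (t ^ 2 + 1)) := by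
  have hM0 : 0 ≤ M := (norm_nonneg _).trans (hM 0)
  have hint := (((integrable_halfPlanePoisson hy t).const_mul ((1 + 2 * R ^ 2) * M)).add
    (hg.norm.const_mul 2)).mul_const (1 / (t ^ 2 + 1))
  refine (norm_integral_le_of_norm_le hint (ae_of_all _ fun x => ?_)).trans_eq ?_
  · have hP := halfPlanePoisson_nonneg hy t x
    simp only [Pi.add_apply]
    rw [norm_smul, Real.norm_of_nonneg hP, mul_one_div, le_div_iff₀ (by positivity)]
    by_cases hx : g x = 0
    · simp only [hx, norm_zero, mul_zero, zero_mul, add_zero]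
      positivity
    have hx2 : x ^ 2 ≤ R ^ 2 := sq_le_sq' (abs_le.1 (hR x hx)).1 (abs_le.1 (hR x hx)).2
    have ht : t ^ 2 + 1 ≤ (1 + 2 * R ^ 2) + 2 * (t - x) ^ 2 := by nlinarith [sq_nonneg (t - 2 * x)]
    have hP1 : halfPlanePoisson y t x * (t - x) ^ 2 ≤ 1 := by
      rw [halfPlanePoisson, div_mul_eq_mul_div, div_le_one (by positivity)]
      nlinarith [sq_nonneg (t - x), sq_nonneg y]
    calc halfPlanePoisson y t x * ‖g x‖ * (t ^ 2 + 1)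
        ≤ halfPlanePoisson y t x * ‖g x‖ * ((1 + 2 * R ^ 2) + 2 * (t - x) ^ 2) := by gcongr
      _ = (1 + 2 * R ^ 2) * ‖g x‖ * halfPlanePoisson y t x +
          2 * (halfPlanePoisson y t x * (t - x) ^ 2) * ‖g x‖ := by ring
      _ ≤ (1 + 2 * R ^ 2) * M * halfPlanePoisson y t x + 2 * 1 * ‖g x‖ := by
        gcongr
        exact hM x
      _ = _ := by ring
  · rw [integral_mul_const]
    simp only [Pi.add_apply]
    rw [integral_add ((integrable_halfPlanePoisson hy t).const_mul _) (hg.norm.const_mul 2),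
      integral_const_mul, integral_const_mul, integral_halfPlanePoisson hy]

theorem stmt_1 (μ : Measure ℝ)
    (hint : Integrable (fun x : ℝ => 1 / (x ^ 2 + 1)) μ)
    (F : ℂ → ℂ)
    (hF : ∀ z : ℂ, z.im ≠ 0 →
      F z = (1 / (2 * Real.pi * I)) *
        ∫ x : ℝ, (1 / ((x : ℂ) - z) - 1 / ((x : ℂ) - I)) ∂μ) :
    DifferentiableOn ℂ F {z : ℂ | z.im ≠ 0} ∧
    ∀ g : ℝ → ℂ, Continuous g → HasCompactSupport g →
      Tendsto
        (fun y : ℝ =>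
          ∫ x : ℝ, (F ((x : ℂ) + (y : ℂ) * I) - F ((x : ℂ) - (y : ℂ) * I)) * g x)
        (𝓝[>] 0)
        (𝓝 (∫ x : ℝ, g x ∂μ)) := by
  have := isLocallyFiniteMeasure_of_integrable_one_div_sq_add_one hint
  refine ⟨?_, fun g hg hgs => ?_⟩
  · have h : DifferentiableOn ℂ (fun z : ℂ => (1 / (2 * Real.pi * I)) *
        ∫ x : ℝ, (1 / ((x : ℂ) - z) - 1 / ((x : ℂ) - I)) ∂μ) {z : ℂ | z.im ≠ 0} := fun z hz =>
      ((differentiableAt_integral_cauchyKernel hint hz).const_mul _).differentiableWithinAt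
    exact h.congr hF
  have hjump : ∀ y : ℝ, 0 < y → ∀ x : ℝ,
      (F ((x : ℂ) + (y : ℂ) * I) - F ((x : ℂ) - (y : ℂ) * I)) * g x =
        Real.pi⁻¹ • ∫ t, halfPlanePoisson y t x • g x ∂μ := by
    intro y hy x
    have h1 : ((x : ℂ) + (y : ℂ) * I).im ≠ 0 := by simpa using hy.ne'
    have h2 : ((x : ℂ) - (y : ℂ) * I).im ≠ 0 := by simpa using hy.ne'
    rw [hF _ h1, hF _ h2, ← mul_sub, ← integral_sub (integrable_cauchyKernel hint h1)
      (integrable_cauchyKernel hint h2), ← integral_const_mul, ← integral_mul_const,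
      ← integral_smul]
    refine integral_congr_ae (ae_of_all _ fun t => ?_)
    simp only [cauchyKernel_jump hy, real_smul]
    rw [div_eq_inv_mul, ofReal_mul, mul_assoc]
  obtain ⟨M, hM⟩ := hgs.exists_bound_of_continuous hg
  obtain ⟨R, hR⟩ := hgs.isCompact.exists_bound_of_continuousOn (f := fun x : ℝ => x) (by fun_prop)
  have hlim : Tendsto (fun y : ℝ => ∫ t, (∫ x, halfPlanePoisson y t x • g x) ∂μ) (𝓝[>] 0)
      (𝓝 (∫ t, Real.pi • g t ∂μ)) := by
    refine tendsto_integral_filter_of_dominated_convergence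
      (fun t => ((1 + 2 * R ^ 2) * M * Real.pi + 2 * ∫ x, ‖g x‖) * (1 / (t ^ 2 + 1))) ?_ ?_
      (hint.const_mul _)
      (ae_of_all _ fun t => tendsto_integral_halfPlanePoisson_smul hg hM t)
    · filter_upwards [self_mem_nhdsWithin] with y hy
      have hc : Continuous fun p : ℝ × ℝ => halfPlanePoisson y p.1 p.2 • g p.2 :=
        (continuous_halfPlanePoisson hy).smul (hg.comp continuous_snd)
      exact hc.stronglyMeasurable.integral_prod_right.aestronglyMeasurable
    · filter_upwards [Ioc_mem_nhdsGT (zero_lt_one' ℝ)] with y hy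
      exact ae_of_all _ fun t => norm_integral_halfPlanePoisson_smul_le
        (hg.integrable_of_hasCompactSupport hgs) hM
        (fun x hx => hR x (subset_tsupport g hx)) hy.1 hy.2 t
  have hlim' := hlim.const_smul Real.pi⁻¹
  rw [integral_smul, smul_smul, inv_mul_cancel₀ Real.pi_ne_zero, one_smul] at hlim'
  refine hlim'.congr' ?_
  filter_upwards [self_mem_nhdsWithin] with y hy
  rw [← integral_integral_halfPlanePoisson_swap hint hg hgs hy, ← integral_smul]
  exact integral_congr_ae (ae_of_all _ fun x => (hjump y hy x).symm)
end

section
/- Let d ≥ 3 be an odd integer, n ≥ 1, let X₁, …, Xₙ be independent standard normal random variables, and let μ be the distribution of X = Σ_{k=1}^n X_k^d, i.e. the pushforward of the n-fold product of the standard Gaussian measure on ℝⁿ under x ↦ Σ_{k=1}^n x_k^d. Then there is ε₀ > 0 such that for every 0 < ε < ε₀, the function g : ℝ → ℂ defined by g(x) = (1/(2π)) ( ψ(x; ε, π, −εd) − ψ(x; −ε, π, π+εd) ) for x > 0 and g(x) = (1/(2π)) ( ψ(x; 0, π−ε, εd) − ψ(x; 0, π+ε, π−εd) ) for x < 0 (and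 g(0) = 0, say) is real-valued almost everywhere and is a density of μ with respect to Lebesgue measure: μ(A) = ∫_A g(x) dx for every Borel set A ⊆ ℝ. -/
open MeasureTheory Complex Filter Topology ProbabilityTheory

noncomputable def phiTheta (d : ℕ) (θ : ℝ) (w : ℂ) : ℂ :=
  (1 / Real.sqrt (2 * Real.pi)) *
    ∫ t in Set.Ioi (0 : ℝ),
      Complex.exp (Complex.I * w * Complex.exp (Complex.I * θ * d) * (t : ℂ) ^ d
          - (1 / 2) * Complex.exp (2 * Complex.I * θ) * (t : ℂ) ^ 2) *
        Complex.exp (Complex.I * θ)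

noncomputable def psiFn (d n : ℕ) (θ θ' φ : ℝ) (z : ℂ) : ℂ :=
  ∫ s in Set.Ioi (0 : ℝ),
    Complex.exp (-Complex.I * z * Complex.exp (Complex.I * φ) * s) *
        (phiTheta d θ (Complex.exp (Complex.I * φ) * s) -
          phiTheta d θ' (Complex.exp (Complex.I * φ) * s)) ^ n *
      Complex.exp (Complex.I * φ)
/-- Contour shift across a closed strip of a function that is holomorphic inside, continuous up to
the boundary, and dominated by an integrable function of the real part vanishing at infinity. -/
theorem integral_horizontal_line_eq (f : ℂ → ℂ) {a b : ℝ} (hab : a ≤ b) {B : ℝ → ℝ}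
    (hc : ContinuousOn f {ζ | ζ.im ∈ Set.Icc a b})
    (hd : DifferentiableOn ℂ f {ζ | ζ.im ∈ Set.Ioo a b})
    (hB : Integrable B) (hbot : Tendsto B atBot (𝓝 0)) (htop : Tendsto B atTop (𝓝 0))
    (hfB : ∀ ζ : ℂ, ζ.im ∈ Set.Icc a b → ‖f ζ‖ ≤ B ζ.re) :
    ∫ x : ℝ, f (x + a * I) = ∫ x : ℝ, f (x + b * I) := by
  have hint : ∀ y ∈ Set.Icc a b, Integrable fun x : ℝ => f (x + y * I) := by
    intro y hy
    refine hB.mono' ?_ (ae_of_all _ fun x => by simpa using hfB (x + y * I) (by simpa using hy))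
    refine Continuous.aestronglyMeasurable ?_
    exact hc.comp_continuous (by fun_prop) fun x => by simpa using hy
  have hlim : ∀ y ∈ Set.Icc a b, Tendsto (fun T : ℝ => ∫ x : ℝ in -T..T, f (x + y * I)) atTop
      (𝓝 (∫ x : ℝ, f (x + y * I))) := fun y hy =>
    intervalIntegral_tendsto_integral (hint y hy) tendsto_neg_atTop_atBot tendsto_id
  have hrect : ∀ T : ℝ, (∫ x : ℝ in -T..T, f (x + a * I)) - (∫ x : ℝ in -T..T, f (x + b * I)) =
      I * (∫ y : ℝ in a..b, f ((-T : ℝ) + y * I)) - I * (∫ y : ℝ in a..b, f (T + y * I)) := by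
    intro T
    have := integral_boundary_rect_eq_zero_of_continuousOn_of_differentiableOn f
      ((-T : ℝ) + a * I) (T + b * I)
      (hc.mono fun ζ hζ => by
        have := hζ.2
        simpa [Set.uIcc_of_le hab] using this)
      (hd.mono fun ζ hζ => by
        have := hζ.2
        simpa [hab] using this)
    simp only [add_re, ofReal_re, mul_re, I_re, mul_zero, ofReal_im, I_im, mul_one, sub_self,
      add_zero, add_im, mul_im, zero_add, smul_eq_mul] at this
    linear_combination this
  have hvert : ∀ T : ℝ, ‖∫ y : ℝ in a..b, f (T + y * I)‖ ≤ B T * |b - a| := by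
    intro T
    refine intervalIntegral.norm_integral_le_of_norm_le_const fun y hy => ?_
    rw [Set.uIoc_of_le hab] at hy
    simpa using hfB (T + y * I) (by simpa using ⟨hy.1.le, hy.2⟩)
  have hv : ∀ l : Filter ℝ, Tendsto B l (𝓝 0) →
      Tendsto (fun T : ℝ => I * ∫ y : ℝ in a..b, f (T + y * I)) l (𝓝 0) := by
    intro l hl
    refine squeeze_zero_norm (a := fun T => B T * |b - a|) (fun T => by simpa using hvert T) ?_
    simpa using hl.mul_const |b - a|
  have h1 := (hlim a ⟨le_rfl, hab⟩).sub (hlim b ⟨hab, le_rfl⟩)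
  have h2 := ((hv _ hbot).comp tendsto_neg_atTop_atBot).sub (hv _ htop)
  simp only [hrect] at h1
  exact sub_eq_zero.1 ((tendsto_nhds_unique h1 h2).trans (sub_zero 0))

theorem integral_Ioi_zero_eq_integral_exp (g : ℝ → ℂ) :
    ∫ s in Set.Ioi (0 : ℝ), g s = ∫ x : ℝ, (Real.exp x : ℂ) * g (Real.exp x) := by
  rw [← Real.range_exp, ← Set.image_univ, integral_image_eq_integral_abs_deriv_smul
    MeasurableSet.univ (fun x _ => (Real.hasDerivAt_exp x).hasDerivWithinAt)
    (Real.exp_injective.injOn)]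
  simp [abs_of_pos (Real.exp_pos _)]

/-- Rotation of the ray of integration inside a closed sector, for a function that decays
exponentially in the sector; the sector is described in logarithmic coordinates. -/
theorem integral_ray_eq (h : ℂ → ℂ) {α β : ℝ} (hαβ : α ≤ β)
    (hc : ContinuousOn (fun ζ => h (exp ζ)) {ζ | ζ.im ∈ Set.Icc α β})
    (hd : DifferentiableOn ℂ (fun ζ => h (exp ζ)) {ζ | ζ.im ∈ Set.Ioo α β}) {C c : ℝ} (hc0 : 0 < c)
    (hb : ∀ ζ : ℂ, ζ.im ∈ Set.Icc α β → ‖h (exp ζ)‖ ≤ C * Real.exp (-c * Real.exp ζ.re)) :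
    ∫ s in Set.Ioi (0 : ℝ), h (exp (I * α) * s) * exp (I * α) =
      ∫ s in Set.Ioi (0 : ℝ), h (exp (I * β) * s) * exp (I * β) := by
  have key : ∀ γ : ℝ, ∫ s in Set.Ioi (0 : ℝ), h (exp (I * γ) * s) * exp (I * γ) =
      ∫ x : ℝ, h (exp (x + γ * I)) * exp (x + γ * I) := by
    intro γ
    rw [integral_Ioi_zero_eq_integral_exp]
    congr 1 with x
    rw [Complex.exp_add, mul_comm (γ : ℂ) I, ofReal_exp, mul_comm (exp (I * γ))]
    ring
  rw [key, key]
  have hg : IntegrableOn (fun s : ℝ => C * Real.exp (-c * s)) (Set.Ioi 0) :=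
    (exp_neg_integrableOn_Ioi 0 hc0).const_mul C
  refine integral_horizontal_line_eq (fun ζ => h (exp ζ) * exp ζ) hαβ
    (B := fun x => Real.exp x * (C * Real.exp (-c * Real.exp x)))
    (hc.mul (by fun_prop)) (hd.mul (by fun_prop)) ?_ ?_ ?_ ?_
  · rw [← Real.range_exp, ← Set.image_univ, integrableOn_image_iff_integrableOn_abs_deriv_smul
      MeasurableSet.univ (fun x _ => (Real.hasDerivAt_exp x).hasDerivWithinAt)
      (Real.exp_injective.injOn)] at hg
    simpa [abs_of_pos (Real.exp_pos _)] using hg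
  · have : Tendsto (fun y : ℝ => y * (C * Real.exp (-c * y))) (𝓝 0) (𝓝 0) := by
      have : Continuous fun y : ℝ => y * (C * Real.exp (-c * y)) := by fun_prop
      simpa using this.tendsto 0
    exact this.comp Real.tendsto_exp_atBot
  · have : Tendsto (fun y : ℝ => C * (y ^ (1 : ℝ) * Real.exp (-c * y))) atTop (𝓝 0) := by
      simpa using (tendsto_rpow_mul_exp_neg_mul_atTop_nhds_zero 1 c hc0).const_mul C
    refine (this.comp Real.tendsto_exp_atTop).congr fun x => ?_
    simp only [Function.comp, Real.rpow_one]
    ring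
  · intro ζ hζ
    rw [norm_mul, Complex.norm_exp, mul_comm]
    exact mul_le_mul_of_nonneg_left (hb ζ hζ) (Real.exp_pos _).le

theorem norm_phiTheta_integrand_le (d : ℕ) (θ : ℝ) {w : ℂ}
    (hw : 0 ≤ (w * exp (I * θ * d)).im) {t : ℝ} (ht : t ∈ Set.Ioi (0 : ℝ)) :
    ‖exp (I * w * exp (I * θ * d) * (t : ℂ) ^ d - (1 / 2) * exp (2 * I * θ) * (t : ℂ) ^ 2) *
      exp (I * θ)‖ ≤ Real.exp (-(Real.cos (2 * θ) / 2) * t ^ 2) := by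
  have h1 : ‖exp (I * θ)‖ = 1 := by rw [mul_comm]; exact norm_exp_ofReal_mul_I θ
  have h2 : (I * w * exp (I * θ * d) * (t : ℂ) ^ d).re = -((w * exp (I * θ * d)).im * t ^ d) := by
    rw [mul_assoc I, mul_assoc I, I_mul_re, ← ofReal_pow, im_mul_ofReal]
  have h3 : ((1 / 2) * exp (2 * I * θ) * (t : ℂ) ^ 2).re = Real.cos (2 * θ) / 2 * t ^ 2 := by
    have : (1 / 2) * exp (2 * I * θ) * (t : ℂ) ^ 2 =
        ((t ^ 2 / 2 : ℝ) : ℂ) * exp ((2 * θ : ℝ) * I) := by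
      push_cast
      ring_nf
    rw [this, re_ofReal_mul, exp_ofReal_mul_I_re]
    ring
  rw [norm_mul, h1, mul_one, Complex.norm_exp, sub_re, h2, h3]
  have := mul_nonneg hw (pow_pos ht d).le
  exact Real.exp_le_exp.2 (by linarith)

theorem integrableOn_gaussian_Ioi {c : ℝ} (hc : 0 < c) :
    IntegrableOn (fun t : ℝ => Real.exp (-c * t ^ 2)) (Set.Ioi 0) :=
  (integrable_exp_neg_mul_sq hc).integrableOn

theorem exists_norm_phiTheta_le (d : ℕ) {θ : ℝ} (hθ : 0 < Real.cos (2 * θ)) :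
    ∃ M : ℝ, ∀ w : ℂ, 0 ≤ (w * exp (I * θ * d)).im → ‖phiTheta d θ w‖ ≤ M := by
  refine ⟨‖(1 / Real.sqrt (2 * Real.pi) : ℂ)‖ *
    ∫ t in Set.Ioi (0 : ℝ), Real.exp (-(Real.cos (2 * θ) / 2) * t ^ 2), fun w hw => ?_⟩
  rw [phiTheta, norm_mul]
  refine mul_le_mul_of_nonneg_left ?_ (norm_nonneg _)
  exact norm_integral_le_of_norm_le (integrableOn_gaussian_Ioi (half_pos hθ))
    ((ae_restrict_iff' measurableSet_Ioi).2 (ae_of_all _ fun t ht =>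
      norm_phiTheta_integrand_le d θ hw ht))

theorem continuousOn_phiTheta (d : ℕ) {θ : ℝ} (hθ : 0 < Real.cos (2 * θ)) :
    ContinuousOn (phiTheta d θ) {w | 0 ≤ (w * exp (I * θ * d)).im} := by
  refine continuousOn_const.mul ?_
  refine continuousOn_of_dominated (fun w _ => Continuous.aestronglyMeasurable (by fun_prop))
    (fun w hw => (ae_restrict_iff' measurableSet_Ioi).2 (ae_of_all _ fun t ht =>
      norm_phiTheta_integrand_le d θ hw ht))
    (integrableOn_gaussian_Ioi (half_pos hθ)) (ae_of_all _ fun t => by fun_prop)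

theorem differentiableOn_phiTheta (d : ℕ) {θ : ℝ} (hθ : 0 < Real.cos (2 * θ)) :
    DifferentiableOn ℂ (phiTheta d θ) {w | 0 < (w * exp (I * θ * d)).im} := by
  have hopen : IsOpen {w : ℂ | 0 < (w * exp (I * θ * d)).im} :=
    isOpen_lt continuous_const (by fun_prop)
  intro w hw
  refine DifferentiableAt.differentiableWithinAt (DifferentiableAt.const_mul ?_ _)
  have hexp : ‖exp (I * θ * d)‖ = 1 := by
    have : I * θ * d = ((θ * d : ℝ) : ℂ) * I := by push_cast; ring
    rw [this]; exact norm_exp_ofReal_mul_I _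
  refine (hasDerivAt_integral_of_dominated_loc_of_deriv_le
    (bound := fun t => t ^ d * Real.exp (-(Real.cos (2 * θ) / 2) * t ^ 2))
    (F' := fun w t => (I * exp (I * θ * d) * (t : ℂ) ^ d) *
      (exp (I * w * exp (I * θ * d) * (t : ℂ) ^ d - (1 / 2) * exp (2 * I * θ) * (t : ℂ) ^ 2) *
      exp (I * θ))) (hopen.mem_nhds hw)
    (Eventually.of_forall fun w => Continuous.aestronglyMeasurable (by fun_prop)) ?_
    (Continuous.aestronglyMeasurable (by fun_prop)) ?_ ?_ ?_).2.differentiableAt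
  · exact (integrableOn_gaussian_Ioi (half_pos hθ)).mono'
      (Continuous.aestronglyMeasurable (by fun_prop))
      ((ae_restrict_iff' measurableSet_Ioi).2 (ae_of_all _ fun t ht =>
        norm_phiTheta_integrand_le d θ (le_of_lt hw) ht))
  · refine (ae_restrict_iff' measurableSet_Ioi).2 (ae_of_all _ fun t ht v hv => ?_)
    rw [norm_mul]
    refine mul_le_mul (le_of_eq ?_) (norm_phiTheta_integrand_le d θ (le_of_lt hv) ht)
      (norm_nonneg _) (pow_pos ht d).le
    rw [norm_mul, norm_mul, hexp, norm_I, norm_pow, norm_real, Real.norm_of_nonneg (le_of_lt ht)]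
    ring
  · have := integrableOn_rpow_mul_exp_neg_mul_sq (half_pos hθ) (s := (d : ℝ))
      (by have := Nat.cast_nonneg (α := ℝ) d; linarith)
    simpa [IntegrableOn] using this
  · refine ae_of_all _ fun t v _ => ?_
    have h1 : HasDerivAt (fun v : ℂ => I * v * exp (I * θ * d) * (t : ℂ) ^ d -
        (1 / 2) * exp (2 * I * θ) * (t : ℂ) ^ 2) (I * exp (I * θ * d) * (t : ℂ) ^ d) v := by
      have := ((((hasDerivAt_id v).const_mul I).mul_const (exp (I * θ * d))).mul_const
        ((t : ℂ) ^ d)).sub_const ((1 / 2) * exp (2 * I * θ) * (t : ℂ) ^ 2)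
      simpa using this
    convert! (h1.cexp.mul_const (exp (I * θ))) using 1
    ring

/-- On the positive real axis the ray of integration in `phiTheta` may be rotated. -/
theorem phiTheta_ofReal_eq_zero_angle {d : ℕ} {ε : ℝ} (hε : 0 ≤ ε) (hcos : 2 * ε < Real.pi / 2)
    (hεd : ε * d ≤ Real.pi) {s : ℝ} (hs : 0 < s) : phiTheta d ε s = phiTheta d 0 s := by
  have hk : 0 < Real.cos (2 * ε) / 2 :=
    half_pos (Real.cos_pos_of_mem_Ioo ⟨by linarith [Real.pi_pos], hcos⟩)
  set k := Real.cos (2 * ε) / 2 with hk_def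
  set h : ℂ → ℂ := fun u => exp (I * s * u ^ d - (1 / 2) * u ^ 2) with hh
  have hphi : ∀ θ : ℝ, phiTheta d θ s =
      (1 / Real.sqrt (2 * Real.pi)) * ∫ t in Set.Ioi (0 : ℝ), h (exp (I * θ) * t) * exp (I * θ) := by
    intro θ
    rw [phiTheta]
    congr 2 with t
    have h1 : exp (I * θ * d) = exp (I * θ) ^ d := by rw [← Complex.exp_nat_mul]; ring_nf
    have h2 : exp (2 * I * θ) = exp (I * θ) ^ 2 := by rw [← Complex.exp_nat_mul]; push_cast; ring_nf
    rw [hh, h1, h2]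
    dsimp only
    rw [mul_pow, mul_pow]
    ring_nf
  have hcont : Differentiable ℂ fun ζ => h (exp ζ) := by
    rw [hh]; fun_prop
  rw [hphi, hphi, ← integral_ray_eq h hε hcont.continuous.continuousOn hcont.differentiableOn
    one_pos (C := Real.exp (1 / (4 * k)))]
  intro ζ hζ
  have e1 : exp ζ ^ d = exp (d * ζ) := (Complex.exp_nat_mul ζ d).symm
  have e2 : exp ζ ^ 2 = exp (2 * ζ) := (Complex.exp_nat_mul ζ 2).symm
  have r1 : (I * s * exp (d * ζ)).re = -(s * (Real.exp (d * ζ.re) * Real.sin (d * ζ.im))) := by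
    rw [mul_assoc, I_mul_re, im_ofReal_mul, exp_im]
    simp
  have r2 : ((1 / 2) * exp (2 * ζ)).re = Real.exp ζ.re ^ 2 * Real.cos (2 * ζ.im) / 2 := by
    have : (1 / 2 : ℂ) = ((1 / 2 : ℝ) : ℂ) := by push_cast; rfl
    rw [this, re_ofReal_mul, exp_re, ← Real.exp_nat_mul]
    simp
    ring
  have hsin : 0 ≤ Real.sin (d * ζ.im) := by
    refine Real.sin_nonneg_of_nonneg_of_le_pi (mul_nonneg (Nat.cast_nonneg d) hζ.1) ?_
    have := mul_le_mul_of_nonneg_left hζ.2 (Nat.cast_nonneg (α := ℝ) d)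
    linarith
  have hcos' : 2 * k ≤ Real.cos (2 * ζ.im) := by
    have := Real.cos_le_cos_of_nonneg_of_le_pi (x := 2 * ζ.im) (y := 2 * ε)
      (by linarith [hζ.1]) (by linarith [Real.pi_pos]) (by linarith [hζ.2])
    linarith
  rw [hh]
  dsimp only
  rw [Complex.norm_exp, sub_re, e1, e2, r1, r2, ← Real.exp_add]
  refine Real.exp_le_exp.2 ?_
  have p1 : 0 ≤ s * (Real.exp (d * ζ.re) * Real.sin (d * ζ.im)) := by positivity
  have p2 := mul_le_mul_of_nonneg_left hcos' (sq_nonneg (Real.exp ζ.re))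
  have p3 : Real.exp ζ.re ≤ 1 / (4 * k) + k * Real.exp ζ.re ^ 2 := by
    have : 1 / (4 * k) + k * Real.exp ζ.re ^ 2 - Real.exp ζ.re =
        (2 * k * Real.exp ζ.re - 1) ^ 2 / (4 * k) := by
      field_simp
      ring
    have : 0 ≤ (2 * k * Real.exp ζ.re - 1) ^ 2 / (4 * k) := by positivity
    linarith
  linarith

/-- The characteristic function of the `d`-th power of a standard normal variable. -/
theorem integral_cexp_pow_gaussianReal {d : ℕ} (hodd : Odd d) (s : ℝ) :
    ∫ x, exp (I * s * (x : ℂ) ^ d) ∂(gaussianReal 0 1) =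
      phiTheta d 0 s - phiTheta d Real.pi s := by
  have hpdf : ∀ x : ℝ, gaussianPDFReal 0 1 x • exp (I * s * (x : ℂ) ^ d) =
      (1 / Real.sqrt (2 * Real.pi)) * exp (I * s * (x : ℂ) ^ d - (1 / 2) * (x : ℂ) ^ 2) := by
    intro x
    rw [gaussianPDFReal, real_smul, sub_eq_add_neg (I * _ * _), Complex.exp_add]
    simp only [NNReal.coe_one, mul_one, sub_zero]
    push_cast
    rw [show -((1 : ℂ) / 2 * x ^ 2) = -(x : ℂ) ^ 2 / 2 by ring]
    ring
  have hint : Integrable fun x : ℝ => (1 / Real.sqrt (2 * Real.pi) : ℂ) *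
      exp (I * s * (x : ℂ) ^ d - (1 / 2) * (x : ℂ) ^ 2) := by
    refine Integrable.const_mul ((integrable_exp_neg_mul_sq (b := 1 / 2) (by norm_num)).mono'
      (Continuous.aestronglyMeasurable (by fun_prop)) (ae_of_all _ fun x => le_of_eq ?_)) _
    rw [Complex.norm_exp]
    congr 1
    have e : I * s * (x : ℂ) ^ d - (1 / 2) * (x : ℂ) ^ 2 =
        ((-(1 / 2) * x ^ 2 : ℝ) : ℂ) + ((s * x ^ d : ℝ) : ℂ) * I := by
      push_cast; ring
    rw [e, add_re, re_ofReal_mul, ofReal_re, I_re]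
    ring
  rw [integral_gaussianReal_eq_integral_smul one_ne_zero]
  simp_rw [hpdf]
  rw [← intervalIntegral.integral_Iic_add_Ioi hint.integrableOn hint.integrableOn (b := 0), add_comm,
    ← neg_zero, ← integral_comp_neg_Ioi, neg_zero, integral_const_mul, integral_const_mul, phiTheta, phiTheta,
    sub_eq_add_neg, ← mul_neg, ← integral_neg]
  have hpi : exp (I * Real.pi) = -1 := by rw [mul_comm]; exact exp_pi_mul_I
  have hpid : exp (I * Real.pi * d) = -1 := by
    rw [mul_comm _ (d : ℂ), Complex.exp_nat_mul, hpi, hodd.neg_one_pow]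
  have hpi2 : exp (2 * I * Real.pi) = 1 := by
    rw [show 2 * I * (Real.pi : ℂ) = 2 * Real.pi * I by ring, exp_two_pi_mul_I]
  congr 3 <;> ext t
  · simp
  · rw [hpi, hpid, hpi2]
    push_cast
    rw [hodd.neg_pow, neg_sq]
    ring_nf

theorem im_exp_mul_exp_I_mul (ζ : ℂ) (γ : ℝ) :
    (exp ζ * exp (I * γ)).im = Real.exp ζ.re * Real.sin (ζ.im + γ) := by
  rw [← Complex.exp_add, exp_im]
  simp

theorem im_exp_mul_exp_I_mul_mul (d : ℕ) (θ : ℝ) (ζ : ℂ) :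
    (exp ζ * exp (I * θ * d)).im = Real.exp ζ.re * Real.sin (ζ.im + θ * d) := by
  rw [← im_exp_mul_exp_I_mul, ofReal_mul, ofReal_natCast, mul_assoc I]

theorem sin_add_pi_mul_of_odd {d : ℕ} (hodd : Odd d) (y : ℝ) :
    Real.sin (y + Real.pi * d) = -Real.sin y := by
  rw [mul_comm, Real.sin_add_nat_mul_pi, hodd.neg_one_pow, neg_one_mul]

section Sector

variable {d : ℕ} {ε : ℝ}

theorem cos_two_mul_pos_of_mul_lt (hd : 3 ≤ d) (hε : 0 < ε) (hεd : ε * d < Real.pi / 2) :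
    0 < Real.cos (2 * ε) := by
  have : (3 : ℝ) ≤ d := by exact_mod_cast hd
  have : ε * 3 ≤ ε * d := mul_le_mul_of_nonneg_left this hε.le
  exact Real.cos_pos_of_mem_Ioo ⟨by linarith [Real.pi_pos], by linarith⟩

theorem exp_mem_closedSector (hodd : Odd d) (hεd : ε * d < Real.pi / 2)
    {ζ : ℂ} (hζ : ζ.im ∈ Set.Icc (-(ε * d)) 0) :
    0 ≤ (exp ζ * exp (I * ε * d)).im ∧ 0 ≤ (exp ζ * exp (I * Real.pi * d)).im := by
  rw [im_exp_mul_exp_I_mul_mul, im_exp_mul_exp_I_mul_mul, sin_add_pi_mul_of_odd hodd]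
  obtain ⟨h1, h2⟩ := hζ
  have hpi := Real.pi_pos
  refine ⟨mul_nonneg (Real.exp_pos _).le
    (Real.sin_nonneg_of_nonneg_of_le_pi (by linarith) (by linarith)),
    mul_nonneg (Real.exp_pos _).le ?_⟩
  rw [← Real.sin_neg]
  exact Real.sin_nonneg_of_nonneg_of_le_pi (by linarith) (by linarith)

theorem exp_mem_openSector (hodd : Odd d) (hεd : ε * d < Real.pi / 2)
    {ζ : ℂ} (hζ : ζ.im ∈ Set.Ioo (-(ε * d)) 0) :
    0 < (exp ζ * exp (I * ε * d)).im ∧ 0 < (exp ζ * exp (I * Real.pi * d)).im := by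
  rw [im_exp_mul_exp_I_mul_mul, im_exp_mul_exp_I_mul_mul, sin_add_pi_mul_of_odd hodd]
  obtain ⟨h1, h2⟩ := hζ
  have hpi := Real.pi_pos
  refine ⟨mul_pos (Real.exp_pos _)
    (Real.sin_pos_of_pos_of_lt_pi (by linarith) (by linarith)),
    mul_pos (Real.exp_pos _) ?_⟩
  rw [← Real.sin_neg]
  exact Real.sin_pos_of_pos_of_lt_pi (by linarith) (by linarith)

theorem cos_two_pi_pos : 0 < Real.cos (2 * Real.pi) := by simp

theorem continuousOn_phiTheta_sub (hd : 3 ≤ d) (hodd : Odd d) (hε : 0 < ε)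
    (hεd : ε * d < Real.pi / 2) :
    ContinuousOn (fun ζ => phiTheta d ε (exp ζ) - phiTheta d Real.pi (exp ζ))
      {ζ | ζ.im ∈ Set.Icc (-(ε * d)) 0} :=
  ((continuousOn_phiTheta d (cos_two_mul_pos_of_mul_lt hd hε hεd)).comp (by fun_prop)
    fun _ hζ => (exp_mem_closedSector hodd hεd hζ).1).sub
  ((continuousOn_phiTheta d cos_two_pi_pos).comp (by fun_prop)
    fun _ hζ => (exp_mem_closedSector hodd hεd hζ).2)

theorem differentiableOn_phiTheta_sub (hd : 3 ≤ d) (hodd : Odd d) (hε : 0 < ε)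
    (hεd : ε * d < Real.pi / 2) :
    DifferentiableOn ℂ (fun ζ => phiTheta d ε (exp ζ) - phiTheta d Real.pi (exp ζ))
      {ζ | ζ.im ∈ Set.Ioo (-(ε * d)) 0} :=
  ((differentiableOn_phiTheta d (cos_two_mul_pos_of_mul_lt hd hε hεd)).comp (by fun_prop)
    fun _ hζ => (exp_mem_openSector hodd hεd hζ).1).sub
  ((differentiableOn_phiTheta d cos_two_pi_pos).comp (by fun_prop)
    fun _ hζ => (exp_mem_openSector hodd hεd hζ).2)

theorem exists_norm_phiTheta_sub_pow_le (n : ℕ) (hd : 3 ≤ d) (hodd : Odd d) (hε : 0 < ε)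
    (hεd : ε * d < Real.pi / 2) :
    ∃ M : ℝ, 0 ≤ M ∧ ∀ ζ : ℂ, ζ.im ∈ Set.Icc (-(ε * d)) 0 →
      ‖(phiTheta d ε (exp ζ) - phiTheta d Real.pi (exp ζ)) ^ n‖ ≤ M := by
  obtain ⟨M₁, h₁⟩ := exists_norm_phiTheta_le d (cos_two_mul_pos_of_mul_lt hd hε hεd)
  obtain ⟨M₂, h₂⟩ := exists_norm_phiTheta_le d cos_two_pi_pos
  have key : ∀ ζ : ℂ, ζ.im ∈ Set.Icc (-(ε * d)) 0 →
      ‖phiTheta d ε (exp ζ) - phiTheta d Real.pi (exp ζ)‖ ≤ |M₁ + M₂| := fun ζ hζ =>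
    ((norm_sub_le _ _).trans (add_le_add (h₁ _ (exp_mem_closedSector hodd hεd hζ).1)
      (h₂ _ (exp_mem_closedSector hodd hεd hζ).2))).trans (le_abs_self _)
  refine ⟨|M₁ + M₂| ^ n, by positivity, fun ζ hζ => ?_⟩
  rw [norm_pow]
  exact pow_le_pow_left₀ (norm_nonneg _) (key ζ hζ) n

/-- Rotating the defining ray of `psiFn` onto the positive real axis turns it into a half-line
Fourier transform of a power of a characteristic function. -/
theorem psiFn_eq_integral_charFun (n : ℕ) (hd : 3 ≤ d) (hodd : Odd d) (hε : 0 < ε)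
    (hεd : ε * d < Real.pi / 2) {x η : ℝ} (hx : 0 < x) (hη : 0 < η) :
    psiFn d n ε Real.pi (-(ε * d)) (x - η * I) =
      ∫ s in Set.Ioi (0 : ℝ), exp (-I * (x - η * I) * s) *
        (∫ u, exp (I * s * (u : ℂ) ^ d) ∂(gaussianReal 0 1)) ^ n := by
  have hd0 : (0 : ℝ) < d := by exact_mod_cast (by omega : 0 < d)
  have hεd0 : 0 < ε * d := mul_pos hε hd0
  have hd3 : (3 : ℝ) ≤ d := by exact_mod_cast hd
  have hε3 : ε * 3 ≤ ε * d := mul_le_mul_of_nonneg_left hd3 hε.le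
  obtain ⟨M, hM0, hM⟩ := exists_norm_phiTheta_sub_pow_le n hd hodd hε hεd
  set h : ℂ → ℂ := fun w => exp (-I * (x - η * I) * w) *
    (phiTheta d ε w - phiTheta d Real.pi w) ^ n with hh
  have hL : psiFn d n ε Real.pi (-(ε * d)) (x - η * I) =
      ∫ s in Set.Ioi (0 : ℝ), h (exp (I * ((-(ε * d) : ℝ) : ℂ)) * s) *
        exp (I * ((-(ε * d) : ℝ) : ℂ)) := by
    rw [psiFn]
    congr 1 with s
    rw [hh]
    dsimp only
    ring_nf
  have hcos : 0 < Real.cos (ε * d) :=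
    Real.cos_pos_of_mem_Ioo ⟨by linarith [Real.pi_pos], hεd⟩
  rw [hL, integral_ray_eq h (neg_nonpos.2 hεd0.le) (C := M) (c := η * Real.cos (ε * d)) ?_ ?_
    (mul_pos hη hcos) ?_]
  · refine setIntegral_congr_fun measurableSet_Ioi fun s hs => ?_
    rw [hh]
    simp only [ofReal_zero, mul_zero, Complex.exp_zero, one_mul, mul_one]
    rw [integral_cexp_pow_gaussianReal hodd,
      phiTheta_ofReal_eq_zero_angle hε.le (by linarith [Real.pi_pos])
      (by linarith [Real.pi_pos]) hs]
  · exact (by fun_prop : Continuous fun ζ => exp (-I * (x - η * I) * exp ζ)).continuousOn.mul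
      ((continuousOn_phiTheta_sub hd hodd hε hεd).pow n)
  · exact (by fun_prop : Differentiable ℂ
      fun ζ => exp (-I * (x - η * I) * exp ζ)).differentiableOn.mul
      ((differentiableOn_phiTheta_sub hd hodd hε hεd).pow n)
  · intro ζ hζ
    rw [hh]
    dsimp only
    rw [norm_mul, mul_comm]
    refine mul_le_mul (hM ζ hζ) ?_ (norm_nonneg _) hM0
    rw [Complex.norm_exp]
    refine Real.exp_le_exp.2 ?_
    have e : (-I * (x - η * I) * exp ζ).re =
        Real.exp ζ.re * (x * Real.sin ζ.im - η * Real.cos ζ.im) := by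
      simp [exp_re, exp_im]
      ring
    rw [e]
    have h1 : Real.sin ζ.im ≤ 0 :=
      Real.sin_nonpos_of_nonpos_of_neg_pi_le hζ.2 (by linarith [hζ.1, Real.pi_pos])
    have h2 : Real.cos (ε * d) ≤ Real.cos ζ.im := by
      rw [← Real.cos_neg ζ.im]
      exact Real.cos_le_cos_of_nonneg_of_le_pi (by linarith [hζ.2]) (by linarith [Real.pi_pos])
        (by linarith [hζ.1])
    have h3 : x * Real.sin ζ.im - η * Real.cos ζ.im ≤ -(η * Real.cos (ε * d)) := by
      have := mul_nonneg hx.le (neg_nonneg.2 h1)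
      have := mul_le_mul_of_nonneg_left h2 hη.le
      linarith
    calc _ ≤ Real.exp ζ.re * -(η * Real.cos (ε * d)) :=
          mul_le_mul_of_nonneg_left h3 (Real.exp_pos _).le
      _ = _ := by ring

theorem continuousOn_psiFn (n : ℕ) (hd : 3 ≤ d) (hodd : Odd d) (hε : 0 < ε)
    (hεd : ε * d < Real.pi / 2) :
    ContinuousOn (psiFn d n ε Real.pi (-(ε * d))) {z | 0 < z.re ∧ z.im ≤ 0} := by
  have hd0 : (0 : ℝ) < d := by exact_mod_cast (by omega : 0 < d)
  have hεd0 : 0 < ε * d := mul_pos hε hd0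
  have hcos : 0 < Real.cos (ε * d) :=
    Real.cos_pos_of_mem_Ioo ⟨by linarith [Real.pi_pos], hεd⟩
  have hsin : 0 < Real.sin (ε * d) :=
    Real.sin_pos_of_pos_of_lt_pi hεd0 (by linarith [Real.pi_pos])
  obtain ⟨M, hM0, hM⟩ := exists_norm_phiTheta_sub_pow_le n hd hodd hε hεd
  have hlog : ∀ s : ℝ, s ∈ Set.Ioi (0 : ℝ) → exp (I * ((-(ε * d) : ℝ) : ℂ)) * s =
      exp (Real.log s + ((-(ε * d) : ℝ) : ℂ) * I) := by
    intro s hs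
    rw [Complex.exp_add, ← ofReal_exp, Real.exp_log hs, mul_comm (I : ℂ), mul_comm]
  have him : ∀ s : ℝ, (Real.log s + ((-(ε * d) : ℝ) : ℂ) * I).im ∈ Set.Icc (-(ε * d)) 0 := by
    intro s
    simp only [add_im, ofReal_im, zero_add, im_ofReal_mul, I_im, mul_one]
    exact ⟨le_rfl, neg_nonpos.2 hεd0.le⟩
  have hPc : ContinuousOn (fun s : ℝ => (phiTheta d ε (exp (I * ((-(ε * d) : ℝ) : ℂ)) * s) -
      phiTheta d Real.pi (exp (I * ((-(ε * d) : ℝ) : ℂ)) * s)) ^ n) (Set.Ioi 0) := by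
    refine ContinuousOn.congr (f := fun s : ℝ =>
      (phiTheta d ε (exp (Real.log s + ((-(ε * d) : ℝ) : ℂ) * I)) -
      phiTheta d Real.pi (exp (Real.log s + ((-(ε * d) : ℝ) : ℂ) * I))) ^ n) ?_
      fun s hs => by dsimp only; rw [hlog s hs]
    refine (((continuousOn_phiTheta_sub hd hodd hε hεd).comp
      (f := fun s : ℝ => (Real.log s + ((-(ε * d) : ℝ) : ℂ) * I)) ?_ fun s _ => him s).pow n)
    have := Real.continuousOn_log.mono
      (fun s hs => (Set.mem_compl_singleton_iff.2 (ne_of_gt hs)) : Set.Ioi (0 : ℝ) ⊆ {0}ᶜ)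
    exact (continuous_ofReal.comp_continuousOn this).add continuousOn_const
  have main : ∀ a : ℝ, 0 < a →
      ContinuousOn (psiFn d n ε Real.pi (-(ε * d))) {z | a < z.re ∧ z.im ≤ 0} := by
    intro a ha
    have hpos : 0 < a * Real.sin (ε * d) := mul_pos ha hsin
    refine continuousOn_of_dominated
      (bound := fun s => Real.exp (-(a * Real.sin (ε * d)) * s) * M) ?_ ?_ ?_ ?_
    · intro z _
      refine ContinuousOn.aestronglyMeasurable ?_ measurableSet_Ioi
      exact ((by fun_prop : Continuous fun s : ℝ =>
        exp (-I * z * exp (I * ((-(ε * d) : ℝ) : ℂ)) * s)).continuousOn.mul hPc).mul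
        continuousOn_const
    · intro z hz
      refine (ae_restrict_iff' measurableSet_Ioi).2 (ae_of_all _ fun s hs => ?_)
      have hs' : 0 < s := hs
      have hn : ‖exp (I * ((-(ε * d) : ℝ) : ℂ))‖ = 1 := by
        rw [mul_comm]; exact norm_exp_ofReal_mul_I _
      rw [norm_mul, hn, mul_one, norm_mul, hlog s hs]
      refine mul_le_mul ?_ (hM _ (him s)) (norm_nonneg _) (Real.exp_pos _).le
      rw [Complex.norm_exp]
      refine Real.exp_le_exp.2 ?_
      have e : (-I * z * exp (I * ((-(ε * d) : ℝ) : ℂ)) * s).re =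
          (-(z.re * Real.sin (ε * d)) + z.im * Real.cos (ε * d)) * s := by
        rw [mul_comm I ((-(ε * d) : ℝ) : ℂ), re_mul_ofReal, mul_assoc, neg_mul, neg_re, I_mul_re,
          neg_neg, mul_im, exp_ofReal_mul_I_re, exp_ofReal_mul_I_im, Real.cos_neg, Real.sin_neg]
        ring
      rw [e]
      refine mul_le_mul_of_nonneg_right ?_ hs'.le
      have h1 := mul_le_mul_of_nonneg_right hz.1.le hsin.le
      have h2 := mul_nonneg (neg_nonneg.2 hz.2) hcos.le
      linarith
    · exact (exp_neg_integrableOn_Ioi 0 hpos).mul_const M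
    · exact ae_of_all _ fun s => by fun_prop
  intro z hz
  have h1 := main (z.re / 2) (half_pos hz.1) z ⟨by linarith [hz.1], hz.2⟩
  refine h1.mono_of_mem_nhdsWithin ?_
  have hopen : IsOpen {w : ℂ | z.re / 2 < w.re} := isOpen_lt continuous_const continuous_re
  filter_upwards [self_mem_nhdsWithin, mem_nhdsWithin_of_mem_nhds
    (hopen.mem_nhds (show z.re / 2 < z.re by linarith [hz.1]))] with w hw1 hw2
  exact ⟨hw2, hw1.2⟩

end Sector

theorem exp_I_mul_add_pi (γ : ℂ) : exp (I * (γ + Real.pi)) = -exp (I * γ) := by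
  rw [mul_add, Complex.exp_add, mul_comm I (Real.pi : ℂ), exp_pi_mul_I, mul_neg_one]

theorem phiTheta_add_pi {d : ℕ} (hodd : Odd d) (θ : ℝ) (w : ℂ) :
    phiTheta d (θ + Real.pi) w = -phiTheta d θ (-w) := by
  rw [phiTheta, phiTheta, ← mul_neg, ← integral_neg]
  have h1 : exp (I * ((θ + Real.pi : ℝ) : ℂ)) = -exp (I * θ) := by
    rw [ofReal_add, exp_I_mul_add_pi]
  have h2 : exp (I * ((θ + Real.pi : ℝ) : ℂ) * d) = -exp (I * θ * d) := by
    rw [mul_comm _ (d : ℂ), Complex.exp_nat_mul, h1, hodd.neg_pow, ← Complex.exp_nat_mul,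
      mul_comm (d : ℂ)]
  have h3 : exp (2 * I * ((θ + Real.pi : ℝ) : ℂ)) = exp (2 * I * θ) := by
    push_cast
    rw [show 2 * I * ((θ : ℂ) + Real.pi) = 2 * I * θ + 2 * Real.pi * I by ring, Complex.exp_add,
      exp_two_pi_mul_I, mul_one]
  rw [h1, h2, h3]
  congr 2 with t
  ring_nf

theorem phiTheta_zero_eq_neg_phiTheta_pi {d : ℕ} (hodd : Odd d) (w : ℂ) :
    phiTheta d 0 w = -phiTheta d Real.pi (-w) := by
  have := phiTheta_add_pi hodd 0 (-w)
  rw [zero_add, neg_neg] at this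
  rw [this, neg_neg]

theorem phiTheta_neg_pi {d : ℕ} (hodd : Odd d) (w : ℂ) :
    phiTheta d (-Real.pi) w = phiTheta d Real.pi w := by
  have := phiTheta_add_pi hodd (-Real.pi) (-w)
  rw [neg_add_cancel, neg_neg, phiTheta_zero_eq_neg_phiTheta_pi hodd, neg_neg] at this
  exact (neg_injective this).symm

theorem conj_phiTheta (d : ℕ) (θ : ℝ) (w : ℂ) :
    starRingEnd ℂ (phiTheta d θ w) = phiTheta d (-θ) (-starRingEnd ℂ w) := by
  rw [phiTheta, phiTheta, map_mul, ← integral_conj]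
  simp only [map_mul, map_sub, map_div₀, map_one, conj_ofReal, conj_I, map_natCast, map_pow,
    ← exp_conj, map_ofNat]
  congr 2 with t
  push_cast
  ring_nf

theorem conj_psiFn {d : ℕ} (n : ℕ) (hodd : Odd d) (θ φ x : ℝ) :
    starRingEnd ℂ (psiFn d n θ Real.pi φ x) = -psiFn d n (-θ) Real.pi (Real.pi - φ) x := by
  rw [psiFn, psiFn, ← integral_conj, ← integral_neg]
  have h : exp (I * ((Real.pi - φ : ℝ) : ℂ)) = -exp (-I * φ) := by
    rw [show I * ((Real.pi - φ : ℝ) : ℂ) = I * (-φ + Real.pi) by push_cast; ring,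
      exp_I_mul_add_pi]
    ring_nf
  congr 1 with s
  rw [h]
  simp only [map_mul, map_sub, conj_ofReal, conj_I, map_pow, ← exp_conj, map_neg, conj_phiTheta,
    phiTheta_neg_pi hodd]
  ring_nf

theorem psiFn_zero_add_pi {d : ℕ} (n : ℕ) (hodd : Odd d) (θ φ : ℝ) (z : ℂ) :
    psiFn d n 0 (θ + Real.pi) φ z = -psiFn d n θ Real.pi (φ + Real.pi) (-z) := by
  rw [psiFn, psiFn, ← integral_neg]
  have h : exp (I * ((φ + Real.pi : ℝ) : ℂ)) = -exp (I * φ) := by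
    rw [ofReal_add, exp_I_mul_add_pi]
  congr 1 with s
  rw [h, phiTheta_zero_eq_neg_phiTheta_pi hodd, phiTheta_add_pi hodd]
  ring_nf

theorem psiFn_add_two_pi (d n : ℕ) (θ θ' φ : ℝ) (z : ℂ) :
    psiFn d n θ θ' (φ + Real.pi + Real.pi) z = psiFn d n θ θ' φ z := by
  have h : exp (I * ((φ + Real.pi + Real.pi : ℝ) : ℂ)) = exp (I * φ) := by
    rw [ofReal_add, exp_I_mul_add_pi, ofReal_add, exp_I_mul_add_pi, neg_neg]
  rw [psiFn, psiFn, h]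

theorem density_eq_of_pos {d : ℕ} (n : ℕ) (hodd : Odd d) (ε x : ℝ) :
    (1 / (2 * Real.pi)) * (psiFn d n ε Real.pi (-(ε * d)) x -
      psiFn d n (-ε) Real.pi (Real.pi + ε * d) x) =
      (((psiFn d n ε Real.pi (-(ε * d)) x).re / Real.pi : ℝ) : ℂ) := by
  have h := conj_psiFn n hodd ε (-(ε * d)) x
  rw [sub_neg_eq_add] at h
  rw [sub_eq_add_neg, ← h, add_conj]
  have : (Real.pi : ℂ) ≠ 0 := ofReal_ne_zero.2 Real.pi_ne_zero
  push_cast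
  field_simp

theorem density_eq_of_neg {d : ℕ} (n : ℕ) (hodd : Odd d) (ε x : ℝ) :
    (1 / (2 * Real.pi)) * (psiFn d n 0 (Real.pi - ε) (ε * d) x -
      psiFn d n 0 (Real.pi + ε) (Real.pi - ε * d) x) =
      (((psiFn d n ε Real.pi (-(ε * d)) (-x : ℝ)).re / Real.pi : ℝ) : ℂ) := by
  rw [← density_eq_of_pos n hodd, show Real.pi - ε = -ε + Real.pi by ring,
    show Real.pi + ε = ε + Real.pi by ring, show Real.pi - ε * d = -(ε * d) + Real.pi by ring,
    psiFn_zero_add_pi n hodd, psiFn_zero_add_pi n hodd, psiFn_add_two_pi,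
    add_comm (ε * d : ℝ) Real.pi, ofReal_neg]
  ring

theorem integral_inv_im_eq_poisson {y x η : ℝ} (hη : 0 < η) :
    (∫ s in Set.Ioi (0 : ℝ), exp ((-I * (x - η * I) + I * y) * s)).re =
      η / (η ^ 2 + (y - x) ^ 2) := by
  have e : -I * (x - η * I) + I * y = ((-η : ℝ) : ℂ) + ((y - x : ℝ) : ℂ) * I := by
    push_cast
    linear_combination (η : ℂ) * I_mul_I
  rw [integral_exp_mul_complex_Ioi (by rw [e]; simpa using hη), e]
  simp [div_re, normSq_apply]
  ring

/-- The real part of the half-line Fourier transform of a characteristic function is the Poisson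
integral of the measure. -/
theorem re_integral_charFun_eq_poisson (μ : Measure ℝ) [IsFiniteMeasure μ] {x η : ℝ} (hη : 0 < η) :
    (∫ s in Set.Ioi (0 : ℝ), exp (-I * (x - η * I) * s) * ∫ y, exp (I * s * y) ∂μ).re =
      ∫ y, η / (η ^ 2 + (y - x) ^ 2) ∂μ := by
  have hnorm : ∀ s y : ℝ, ‖exp ((-I * (x - η * I) + I * y) * s)‖ = Real.exp (-η * s) := by
    intro s y
    rw [Complex.norm_exp]
    congr 1
    simp
  have hint : Integrable (Function.uncurry fun s y : ℝ => exp ((-I * (x - η * I) + I * y) * s))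
      ((volume.restrict (Set.Ioi 0)).prod μ) := by
    have h : Integrable (fun p : ℝ × ℝ => Real.exp (-η * p.1))
        ((volume.restrict (Set.Ioi 0)).prod μ) :=
      (exp_neg_integrableOn_Ioi 0 hη).integrable.comp_fst μ
    exact h.mono' (Continuous.aestronglyMeasurable (by fun_prop))
      (ae_of_all _ fun p => (hnorm p.1 p.2).le)
  have hswap : (∫ s in Set.Ioi (0 : ℝ), exp (-I * (x - η * I) * s) * ∫ y, exp (I * s * y) ∂μ) =
      ∫ y, (∫ s in Set.Ioi (0 : ℝ), exp ((-I * (x - η * I) + I * y) * s)) ∂μ := by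
    rw [← integral_integral_swap hint]
    congr 1 with s
    rw [← integral_const_mul]
    congr 1 with y
    rw [← Complex.exp_add]
    ring_nf
  rw [hswap]
  refine (integral_re hint.integral_prod_right).symm.trans ?_
  congr 1 with y
  exact integral_inv_im_eq_poisson hη

theorem integral_poisson_kernel {η : ℝ} (hη : 0 < η) (a b y : ℝ) :
    ∫ x in a..b, η / (η ^ 2 + (y - x) ^ 2) =
      Real.arctan ((b - y) / η) - Real.arctan ((a - y) / η) := by
  have hpos : ∀ x : ℝ, 0 < η ^ 2 + (y - x) ^ 2 := fun x => by positivity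
  refine intervalIntegral.integral_eq_sub_of_hasDerivAt
    (f := fun x => Real.arctan ((x - y) / η)) (fun x _ => ?_) ?_
  · convert! (((hasDerivAt_id x).sub_const y).div_const η).arctan using 1
    have := (hpos x).ne'
    have h2 : 1 + ((x - y) / η) ^ 2 = (η ^ 2 + (y - x) ^ 2) / η ^ 2 := by
      field_simp
      ring
    simp only [id]
    rw [h2]
    field_simp
  · refine Continuous.intervalIntegrable ?_ _ _
    exact continuous_const.div (by fun_prop) fun x => (hpos x).ne'

theorem tendsto_arctan_div_nhdsGT_zero {c : ℝ} (hc : 0 < c) :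
    Tendsto (fun η : ℝ => Real.arctan (c / η)) (𝓝[>] 0) (𝓝 (Real.pi / 2)) := by
  have h : Tendsto (fun η : ℝ => c / η) (𝓝[>] 0) atTop := by
    simpa [div_eq_mul_inv] using tendsto_inv_nhdsGT_zero.const_mul_atTop hc
  exact (Real.tendsto_arctan_atTop.mono_right nhdsWithin_le_nhds).comp h

theorem tendsto_arctan_div_nhdsGT_zero_of_neg {c : ℝ} (hc : c < 0) :
    Tendsto (fun η : ℝ => Real.arctan (c / η)) (𝓝[>] 0) (𝓝 (-(Real.pi / 2))) := by
  refine (tendsto_arctan_div_nhdsGT_zero (neg_pos.2 hc)).neg.congr fun η => ?_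
  rw [neg_div, Real.arctan_neg, neg_neg]

/-- Stieltjes inversion on an interval with endpoints of zero mass. -/
theorem tendsto_integral_poisson (μ : Measure ℝ) [IsFiniteMeasure μ] {a b : ℝ} (hab : a < b)
    (ha : μ {a} = 0) (hb : μ {b} = 0) :
    Tendsto (fun η : ℝ => ∫ x in a..b, ∫ y, η / (η ^ 2 + (y - x) ^ 2) ∂μ) (𝓝[>] 0)
      (𝓝 (Real.pi * μ.real (Set.Ioo a b))) := by
  have hswap : ∀ η : ℝ, 0 < η → ∫ x in a..b, ∫ y, η / (η ^ 2 + (y - x) ^ 2) ∂μ =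
      ∫ y, (Real.arctan ((b - y) / η) - Real.arctan ((a - y) / η)) ∂μ := by
    intro η hη
    have hpos : ∀ x y : ℝ, 0 < η ^ 2 + (y - x) ^ 2 := fun x y => by positivity
    rw [intervalIntegral.integral_of_le hab.le, integral_integral_swap]
    · congr 1 with y
      rw [← intervalIntegral.integral_of_le hab.le, integral_poisson_kernel hη]
    · refine Integrable.of_bound (C := 1 / η) (Continuous.aestronglyMeasurable ?_)
        (ae_of_all _ fun p => ?_)
      · exact continuous_const.div (by fun_prop) fun p => (hpos p.1 p.2).ne'
      · simp only [Function.uncurry]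
        rw [Real.norm_of_nonneg (div_nonneg hη.le (hpos _ _).le), div_le_div_iff₀ (hpos _ _) hη]
        nlinarith [sq_nonneg (p.2 - p.1)]
  have hlim : ∫ y, (Set.Ioo a b).indicator (fun _ => Real.pi) y ∂μ =
      Real.pi * μ.real (Set.Ioo a b) := by
    rw [integral_indicator_const _ measurableSet_Ioo, smul_eq_mul, mul_comm]
  rw [← hlim]
  refine Tendsto.congr' (f₁ := fun η : ℝ =>
    ∫ y, (Real.arctan ((b - y) / η) - Real.arctan ((a - y) / η)) ∂μ)
    (by filter_upwards [self_mem_nhdsWithin] with η hη using (hswap η hη).symm) ?_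
  refine tendsto_integral_filter_of_dominated_convergence (fun _ => Real.pi) ?_ ?_
    (integrable_const _) ?_
  · exact Eventually.of_forall fun η => Continuous.aestronglyMeasurable (by fun_prop)
  · refine Eventually.of_forall fun η => ae_of_all _ fun y => ?_
    rw [Real.norm_eq_abs, abs_le]
    constructor <;>
    linarith [Real.arctan_lt_pi_div_two ((b - y) / η), Real.neg_pi_div_two_lt_arctan ((b - y) / η),
      Real.arctan_lt_pi_div_two ((a - y) / η), Real.neg_pi_div_two_lt_arctan ((a - y) / η)]
  · have hne : ∀ᵐ y ∂μ, y ≠ a ∧ y ≠ b :=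
      (measure_eq_zero_iff_ae_notMem.1 ha).and (measure_eq_zero_iff_ae_notMem.1 hb)
    filter_upwards [hne] with y hy
    rcases lt_or_gt_of_ne hy.1 with h | h
    · rw [Set.indicator_of_notMem fun h' => h.not_gt h'.1]
      simpa using (tendsto_arctan_div_nhdsGT_zero (sub_pos.2 (h.trans hab))).sub
        (tendsto_arctan_div_nhdsGT_zero (sub_pos.2 h))
    rcases lt_or_gt_of_ne hy.2 with h' | h'
    · rw [Set.indicator_of_mem (show y ∈ Set.Ioo a b from ⟨h, h'⟩)]
      simpa using (tendsto_arctan_div_nhdsGT_zero (sub_pos.2 h')).sub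
        (tendsto_arctan_div_nhdsGT_zero_of_neg (sub_neg.2 h))
    · rw [Set.indicator_of_notMem fun h'' => h'.not_gt h''.2]
      simpa using (tendsto_arctan_div_nhdsGT_zero_of_neg (sub_neg.2 h')).sub
        (tendsto_arctan_div_nhdsGT_zero_of_neg (sub_neg.2 h))

section BoundaryValue

variable {μ : Measure ℝ} {Ψ : ℂ → ℂ}

theorem continuousWithinAt_sub_mul_I (hΨ : ContinuousOn Ψ {z | 0 < z.re ∧ z.im ≤ 0}) {x : ℝ}
    (hx : 0 < x) : Tendsto (fun η : ℝ => (Ψ (x - η * I)).re) (𝓝[>] 0) (𝓝 (Ψ x).re) := by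
  refine (continuous_re.tendsto _).comp ((hΨ x ⟨by simpa using hx, by simp⟩).tendsto.comp ?_)
  refine tendsto_nhdsWithin_iff.2 ⟨?_, ?_⟩
  · have : Continuous fun η : ℝ => (x - η * I : ℂ) := by fun_prop
    simpa using (this.tendsto 0).mono_left nhdsWithin_le_nhds
  · filter_upwards [self_mem_nhdsWithin] with η hη
    have : 0 < η := hη
    simp [hx, this.le]

theorem re_nonneg_of_eq_poisson (hΨ : ContinuousOn Ψ {z | 0 < z.re ∧ z.im ≤ 0})
    (hμ : ∀ x η : ℝ, 0 < x → 0 < η → (Ψ (x - η * I)).re = ∫ y, η / (η ^ 2 + (y - x) ^ 2) ∂μ)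
    {x : ℝ} (hx : 0 < x) : 0 ≤ (Ψ x).re := by
  refine ge_of_tendsto (continuousWithinAt_sub_mul_I hΨ hx) ?_
  filter_upwards [self_mem_nhdsWithin] with η hη
  have hη' : 0 < η := hη
  rw [hμ x η hx hη]
  exact integral_nonneg fun y => by positivity

theorem integral_re_eq_of_eq_poisson [IsFiniteMeasure μ]
    (hΨ : ContinuousOn Ψ {z | 0 < z.re ∧ z.im ≤ 0})
    (hμ : ∀ x η : ℝ, 0 < x → 0 < η → (Ψ (x - η * I)).re = ∫ y, η / (η ^ 2 + (y - x) ^ 2) ∂μ)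
    {a b : ℝ} (ha : 0 < a) (hab : a < b) (hμa : μ {a} = 0) (hμb : μ {b} = 0) :
    ∫ x in a..b, (Ψ x).re = Real.pi * μ.real (Set.Ioo a b) := by
  refine tendsto_nhds_unique ?_ (tendsto_integral_poisson μ hab hμa hμb)
  have hmem : ∀ x ∈ Set.Icc a b, ∀ η ∈ Set.Icc (0 : ℝ) 1,
      (x - η * I : ℂ) ∈ Set.Icc a b ×ℂ Set.Icc (-1) 0 := by
    intro x hx η hη
    refine ⟨by simpa using hx, ?_⟩
    simpa using ⟨hη.2, hη.1⟩
  have hsub : Set.Icc a b ×ℂ Set.Icc (-1) 0 ⊆ {z | 0 < z.re ∧ z.im ≤ 0} :=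
    fun z hz => ⟨ha.trans_le hz.1.1, hz.2.2⟩
  obtain ⟨C, hC⟩ := ((isCompact_Icc.reProdIm isCompact_Icc).exists_bound_of_continuousOn
    (hΨ.mono hsub) :)
  have hev : ∀ᶠ η : ℝ in 𝓝[>] 0, η ∈ Set.Ioc (0 : ℝ) 1 := Ioc_mem_nhdsGT one_pos
  refine Tendsto.congr' (f₁ := fun η : ℝ => ∫ x in a..b, (Ψ (x - η * I)).re) ?_ ?_
  · filter_upwards [hev] with η hη
    refine intervalIntegral.integral_congr fun x hx => ?_
    rw [Set.uIcc_of_le hab.le] at hx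
    exact hμ x η (ha.trans_le hx.1) hη.1
  · refine intervalIntegral.tendsto_integral_filter_of_dominated_convergence (fun _ => C) ?_ ?_
      intervalIntegrable_const ?_
    · filter_upwards [hev] with η hη
      rw [Set.uIoc_of_le hab.le]
      refine ContinuousOn.aestronglyMeasurable ?_ measurableSet_Ioc
      refine continuous_re.comp_continuousOn ((hΨ.mono hsub).comp (by fun_prop) fun x hx =>
        hmem x ⟨hx.1.le, hx.2⟩ η ⟨hη.1.le, hη.2⟩)
    · filter_upwards [hev] with η hη
      refine ae_of_all _ fun x hx => ?_
      rw [Set.uIoc_of_le hab.le] at hx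
      exact (Complex.abs_re_le_norm _).trans
        (hC _ (hmem x ⟨hx.1.le, hx.2⟩ η ⟨hη.1.le, hη.2⟩))
    · refine ae_of_all _ fun x hx => ?_
      rw [Set.uIoc_of_le hab.le] at hx
      exact continuousWithinAt_sub_mul_I hΨ (ha.trans hx.1)

end BoundaryValue

/-- A finite even measure without atoms whose mass of every compact interval of the positive
half-line is the integral of an even function `G` has density `G`. -/
theorem eq_withDensity_of_even {μ : Measure ℝ} [IsFiniteMeasure μ] (hatom : ∀ x, μ {x} = 0)
    (hneg : μ.map (fun x => -x) = μ) {G : ℝ → ℝ} (hGm : Measurable G) (hG0 : ∀ x, 0 ≤ G x)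
    (hGeven : ∀ x, G (-x) = G x)
    (hGi : ∀ a b : ℝ, 0 < a → a < b → IntervalIntegrable G volume a b)
    (hG : ∀ a b : ℝ, 0 < a → a < b → ∫ x in a..b, G x = μ.real (Set.Ioo a b)) :
    μ = volume.withDensity fun x => ENNReal.ofReal (G x) := by
  set ν := volume.withDensity fun x => ENNReal.ofReal (G x) with hν
  have hIoc : ∀ a b : ℝ, 0 < a → μ (Set.Ioc a b) = ν (Set.Ioc a b) := by
    intro a b ha
    rcases le_or_gt b a with h | h
    · simp [Set.Ioc_eq_empty_of_le h]
    · have h1 : μ (Set.Ioc a b) = μ (Set.Ioo a b) := by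
        rw [← Set.Ioo_union_right h]
        exact le_antisymm ((measure_union_le _ _).trans (by simp [hatom]))
          (measure_mono Set.subset_union_left)
      rw [hν, withDensity_apply _ measurableSet_Ioc, ← ofReal_integral_eq_lintegral_ofReal
        ((intervalIntegrable_iff_integrableOn_Ioc_of_le h.le).1 (hGi a b ha h))
        (ae_of_all _ hG0), ← intervalIntegral.integral_of_le h.le, hG a b ha h, h1,
        ofReal_measureReal]
  have hrestr : ∀ a b : ℝ, 0 < a → μ.restrict (Set.Ioc a b) = ν.restrict (Set.Ioc a b) := by
    intro a b ha
    refine Measure.ext_of_Ioc _ _ fun c e _ => ?_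
    rw [Measure.restrict_apply measurableSet_Ioc, Measure.restrict_apply measurableSet_Ioc,
      Set.Ioc_inter_Ioc]
    exact hIoc _ _ (ha.trans_le le_sup_right)
  have hpos : μ.restrict (Set.Ioi 0) = ν.restrict (Set.Ioi 0) := by
    have hU : Set.Ioi (0 : ℝ) = ⋃ k : ℕ, Set.Ioc (1 / ((k : ℝ) + 1)) (k + 1) := by
      ext x
      simp only [Set.mem_Ioi, Set.mem_iUnion, Set.mem_Ioc]
      constructor
      · intro hx
        obtain ⟨k, hk⟩ := exists_nat_gt (max x (1 / x))
        have hk0 : (0 : ℝ) < k + 1 := by positivity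
        refine ⟨k, ?_, by linarith [le_max_left x (1 / x)]⟩
        rw [div_lt_comm₀ hk0 hx]
        linarith [le_max_right x (1 / x)]
      · rintro ⟨k, hk, _⟩
        exact lt_trans (by positivity) hk
    rw [hU, Measure.restrict_iUnion_congr]
    exact fun k => hrestr _ _ (by positivity)
  have hνneg : ∀ S, MeasurableSet S → ν ((fun x => -x) ⁻¹' S) = ν S := by
    intro S hS
    rw [hν, withDensity_apply _ (measurable_neg hS), withDensity_apply _ hS,
      ← (Measure.measurePreserving_neg (volume : Measure ℝ)).setLIntegral_comp_preimage hS
        (by fun_prop)]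
    simp_rw [hGeven]
  have hnegpart : μ.restrict (Set.Iio 0) = ν.restrict (Set.Iio 0) := by
    ext S hS
    have hS' : MeasurableSet ((fun x : ℝ => -x) ⁻¹' S) := measurable_neg hS
    have hpre : (fun x : ℝ => -x) ⁻¹' (S ∩ Set.Iio 0) = (fun x : ℝ => -x) ⁻¹' S ∩ Set.Ioi 0 := by
      ext x; simp
    rw [Measure.restrict_apply hS, Measure.restrict_apply hS,
      ← hνneg _ (hS.inter measurableSet_Iio), ← hneg,
      Measure.map_apply measurable_neg (hS.inter measurableSet_Iio), hpre,
      ← Measure.restrict_apply hS', ← Measure.restrict_apply hS', hpos]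
  have hzero : μ.restrict {0} = ν.restrict {0} := by
    rw [Measure.restrict_eq_zero.2 (hatom 0), Measure.restrict_eq_zero.2 ?_]
    exact withDensity_absolutelyContinuous _ _ (by simp)
  have huniv : Set.Iio (0 : ℝ) ∪ ({0} ∪ Set.Ioi 0) = Set.univ := by
    ext x
    rcases lt_trichotomy x 0 with h | h | h <;> simp [h]
  rw [← Measure.restrict_univ (μ := μ), ← Measure.restrict_univ (μ := ν), ← huniv,
    Measure.restrict_union_congr, Measure.restrict_union_congr]
  exact ⟨hnegpart, hzero, hpos⟩

theorem measurable_sum_pow (d n : ℕ) : Measurable fun x : Fin n → ℝ => ∑ k, x k ^ d := by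
  fun_prop

theorem integral_cexp_map_sum_pow (ρ : Measure ℝ) [SigmaFinite ρ] (d n : ℕ) (s : ℝ) :
    ∫ y, exp (I * s * (y : ℂ)) ∂(Measure.map (fun x : Fin n → ℝ => ∑ k, x k ^ d)
      (Measure.pi fun _ : Fin n => ρ)) = (∫ u, exp (I * s * (u : ℂ) ^ d) ∂ρ) ^ n := by
  rw [integral_map (measurable_sum_pow d n).aemeasurable
    (Continuous.aestronglyMeasurable (by fun_prop))]
  have := integral_fintype_prod_eq_pow (ι := Fin n) (μ := ρ)
    (fun u : ℝ => exp (I * s * (u : ℂ) ^ d))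
  rw [Fintype.card_fin] at this
  rw [← this]
  congr 1 with x
  rw [← Complex.exp_sum, ← Finset.mul_sum]
  push_cast
  rfl

theorem map_neg_map_sum_pow {ρ : Measure ℝ} [SigmaFinite ρ] (hρ : ρ.map (fun x => -x) = ρ)
    {d : ℕ} (hodd : Odd d) (n : ℕ) :
    (Measure.map (fun x : Fin n → ℝ => ∑ k, x k ^ d) (Measure.pi fun _ : Fin n => ρ)).map
      (fun y => -y) =
    Measure.map (fun x : Fin n → ℝ => ∑ k, x k ^ d) (Measure.pi fun _ : Fin n => ρ) := by
  have hmp : MeasurePreserving (fun (x : Fin n → ℝ) i => -x i) (Measure.pi fun _ => ρ)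
      (Measure.pi fun _ => ρ) :=
    measurePreserving_pi _ _ fun _ => ⟨measurable_neg, hρ⟩
  rw [Measure.map_map measurable_neg (measurable_sum_pow d n)]
  conv_rhs => rw [← hmp.map_eq, Measure.map_map (measurable_sum_pow d n) hmp.measurable]
  congr 1 with x
  simp [hodd.neg_pow]

theorem map_sum_pow_singleton {ρ : Measure ℝ} [SigmaFinite ρ] (hρ : ∀ x, ρ {x} = 0)
    {d : ℕ} (hodd : Odd d) {n : ℕ} (hn : 1 ≤ n) (c : ℝ) :
    Measure.map (fun x : Fin n → ℝ => ∑ k, x k ^ d) (Measure.pi fun _ : Fin n => ρ) {c} = 0 := by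
  obtain ⟨m, rfl⟩ := Nat.exists_eq_add_of_le' hn
  rw [Measure.map_apply (measurable_sum_pow d _) (measurableSet_singleton c)]
  have hmp := (measurePreserving_piFinSuccAbove (fun _ : Fin (m + 1) => ρ) 0).symm
  have hS : MeasurableSet ((fun x : Fin (m + 1) → ℝ => ∑ k, x k ^ d) ⁻¹' {c}) :=
    measurable_sum_pow d _ (measurableSet_singleton c)
  rw [← hmp.measure_preimage hS.nullMeasurableSet, Measure.prod_apply_symm (hmp.measurable hS),
    lintegral_eq_zero_iff' (measurable_measure_prodMk_right (hmp.measurable hS)).aemeasurable]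
  refine ae_of_all _ fun y => ?_
  have hsub : ((fun x => (x, y)) ⁻¹' ((MeasurableEquiv.piFinSuccAbove (fun _ => ℝ) 0).symm ⁻¹'
      ((fun x : Fin (m + 1) → ℝ => ∑ k, x k ^ d) ⁻¹' {c}))).Subsingleton := by
    intro x hx x' hx'
    simp only [Set.mem_preimage, Set.mem_singleton_iff, Fin.sum_univ_succ,
      MeasurableEquiv.piFinSuccAbove_symm_apply, Fin.insertNthEquiv, Equiv.coe_fn_mk,
      Fin.insertNth_zero', Fin.cons_zero, Fin.cons_succ] at hx hx'
    exact hodd.strictMono_pow.injective (add_right_cancel (hx.trans hx'.symm))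
  rcases hsub.eq_empty_or_singleton with h | ⟨x, h⟩
  · simp only [h, measure_empty, Pi.zero_apply]
  · simp only [h, hρ, Pi.zero_apply]

theorem stmt_15 (d n : ℕ) (hd : 3 ≤ d) (hodd : Odd d) (hn : 1 ≤ n)
    (μ : Measure ℝ)
    (hμ : μ = Measure.map (fun x : Fin n → ℝ => ∑ k, x k ^ d)
      (Measure.pi fun _ : Fin n => gaussianReal 0 1)) :
    ∃ ε₀ : ℝ, 0 < ε₀ ∧ ∀ ε : ℝ, 0 < ε → ε < ε₀ →
      ∀ g : ℝ → ℂ,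
        (∀ x : ℝ, 0 < x → g x = (1 / (2 * Real.pi)) *
          (psiFn d n ε Real.pi (-(ε * d)) x -
            psiFn d n (-ε) Real.pi (Real.pi + ε * d) x)) →
        (∀ x : ℝ, x < 0 → g x = (1 / (2 * Real.pi)) *
          (psiFn d n 0 (Real.pi - ε) (ε * d) x -
            psiFn d n 0 (Real.pi + ε) (Real.pi - ε * d) x)) →
        g 0 = 0 →
        (∀ᵐ x : ℝ ∂volume, (g x).im = 0) ∧
        ∀ A : Set ℝ, MeasurableSet A →
          (∫ x in A, g x ∂volume) = (((μ A).toReal : ℝ) : ℂ) := by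
  have hd0 : (0 : ℝ) < d := by exact_mod_cast (by omega : 0 < d)
  refine ⟨Real.pi / 2 / d, by positivity, fun ε hε hε₀ g hgpos hgneg hg0 => ?_⟩
  have hεd : ε * d < Real.pi / 2 := (lt_div_iff₀ hd0).1 hε₀
  have : IsProbabilityMeasure μ := by
    rw [hμ]
    exact Measure.isProbabilityMeasure_map (measurable_sum_pow d n).aemeasurable
  set Ψ := psiFn d n ε Real.pi (-(ε * d)) with hΨ_def
  have hΨ : ContinuousOn Ψ {z | 0 < z.re ∧ z.im ≤ 0} := continuousOn_psiFn n hd hodd hε hεd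
  have hPoisson : ∀ x η : ℝ, 0 < x → 0 < η →
      (Ψ (x - η * I)).re = ∫ y, η / (η ^ 2 + (y - x) ^ 2) ∂μ := by
    intro x η hx hη
    rw [hΨ_def, psiFn_eq_integral_charFun n hd hodd hε hεd hx hη,
      ← re_integral_charFun_eq_poisson μ hη]
    simp_rw [← integral_cexp_map_sum_pow, ← hμ]
  set G : ℝ → ℝ := fun x => (g x).re with hG_def
  have hGpos : ∀ x : ℝ, 0 < x → g x = (((Ψ x).re / Real.pi : ℝ) : ℂ) := fun x hx => by
    rw [hgpos x hx, density_eq_of_pos n hodd]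
  have hGneg : ∀ x : ℝ, x < 0 → g x = (((Ψ (-x : ℝ)).re / Real.pi : ℝ) : ℂ) := fun x hx => by
    rw [hgneg x hx, density_eq_of_neg n hodd]
  have hGpos' : ∀ x : ℝ, 0 < x → G x = (Ψ x).re / Real.pi := fun x hx => by
    rw [hG_def]; dsimp only; rw [hGpos x hx, ofReal_re]
  have hgG : ∀ x, g x = (G x : ℂ) := by
    intro x
    rcases lt_trichotomy x 0 with h | h | h
    · rw [hG_def]; dsimp only; rw [hGneg x h, ofReal_re]
    · simp [hG_def, h, hg0]
    · rw [hG_def]; dsimp only; rw [hGpos x h, ofReal_re]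
  have hGeven : ∀ x, G (-x) = G x := by
    intro x
    rw [hG_def]
    dsimp only
    rcases lt_trichotomy x 0 with h | h | h
    · rw [hGneg x h, hGpos (-x) (neg_pos.2 h)]
    · simp [h]
    · rw [hGneg (-x) (neg_neg_iff_pos.2 h), hGpos x h, neg_neg]
  have hG0 : ∀ x, 0 ≤ G x := by
    have hp : ∀ x : ℝ, 0 < x → 0 ≤ G x := fun x hx => by
      rw [hGpos' x hx]
      exact div_nonneg (re_nonneg_of_eq_poisson hΨ hPoisson hx) Real.pi_pos.le
    intro x
    rcases lt_trichotomy x 0 with h | h | h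
    · rw [← hGeven]; exact hp _ (neg_pos.2 h)
    · simp [hG_def, h, hg0]
    · exact hp x h
  have hGc : ContinuousOn G (Set.Ioi 0) := by
    refine ContinuousOn.congr (f := fun x : ℝ => (Ψ x).re / Real.pi) ?_ fun x hx => hGpos' x hx
    refine (continuous_re.comp_continuousOn (hΨ.comp (by fun_prop) fun x hx => ?_)).div_const _
    have hx' : 0 < x := hx
    simpa using hx'
  have hGm : Measurable G := by
    have habs : G = fun x => (Set.Ioi (0 : ℝ)).indicator G |x| := by
      ext x
      rcases lt_trichotomy x 0 with h | h | h
      · rw [abs_of_neg h, Set.indicator_of_mem (show -x ∈ Set.Ioi (0 : ℝ) from neg_pos.2 h), hGeven]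
      · simp [hG_def, h, hg0]
      · rw [abs_of_pos h, Set.indicator_of_mem (show x ∈ Set.Ioi (0 : ℝ) from h)]
    have hind : Measurable ((Set.Ioi (0 : ℝ)).indicator G) := by
      classical
      rw [← Set.piecewise_eq_indicator]
      exact hGc.measurable_piecewise continuousOn_const measurableSet_Ioi
    rw [habs]
    exact hind.comp continuous_abs.measurable
  have hatom : ∀ x, μ {x} = 0 := by
    rw [hμ]
    have := nullSingletonClass_gaussianReal (μ := 0) (v := 1) one_ne_zero
    exact map_sum_pow_singleton (fun x => measure_singleton x) hodd hn
  have hneg : μ.map (fun x => -x) = μ := by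
    rw [hμ]
    exact map_neg_map_sum_pow (by rw [gaussianReal_map_neg, neg_zero]) hodd n
  have hdens := eq_withDensity_of_even hatom hneg hGm hG0 hGeven
    (fun a b ha hab => (hGc.mono fun x hx => by
      rw [Set.uIcc_of_le hab.le] at hx
      exact ha.trans_le hx.1).intervalIntegrable)
    (fun a b ha hab => by
      have h1 : ∫ x in a..b, G x = ∫ x in a..b, (Ψ x).re / Real.pi := by
        refine intervalIntegral.integral_congr fun x hx => ?_
        rw [Set.uIcc_of_le hab.le] at hx
        exact hGpos' x (ha.trans_le hx.1)
      rw [h1, intervalIntegral.integral_div,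
        integral_re_eq_of_eq_poisson hΨ hPoisson ha hab (hatom a) (hatom b),
        mul_div_cancel_left₀ _ Real.pi_ne_zero])
  refine ⟨ae_of_all _ fun x => by rw [hgG x, ofReal_im], fun A hA => ?_⟩
  simp_rw [hgG]
  rw [integral_complex_ofReal, integral_eq_lintegral_of_nonneg_ae (ae_of_all _ hG0)
    hGm.aestronglyMeasurable, ← withDensity_apply _ hA, ← hdens]
end
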